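/- For any canonical module ω_R of R, the socle Hom_R(𝕜, H^m_𝔪(H^{n−1}_I(ω_R))) is an infinite-dimensional 𝕜-vector space. -/

import Mathlib

open CategoryTheory Opposite MvPowerSeries

set_option synthInstance.maxHeartbeats 1000000
set_option maxHeartbeats 1000000

noncomputable section

/-- The grade of an ideal: the maximal length of a regular sequence contained in it. -/
def idealGrade {A : Type} [CommRing A] (J : Ideal A) : ℕ∞ :=
  sSup {c : ℕ∞ | ∃ rs : List A, (∀ r ∈ rs, r ∈ J) ∧
    RingTheory.Sequence.IsRegular A rs ∧ (rs.length : ℕ∞) = c}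

/-- The height of an ideal: the infimum of heights of primes containing it. -/
def idealHeight {A : Type} [CommRing A] (J : Ideal A) : ℕ∞ :=
  sInf {h : ℕ∞ | ∃ p : PrimeSpectrum A, J ≤ p.asIdeal ∧ Order.height p = h}

/-- A canonical module of a `d`-dimensional local ring `A`: a finitely generated module `ω`
with `Ext_A^i(𝕜, ω) = 0` for `i ≠ d` and `Ext_A^d(𝕜, ω)` a one-dimensional `𝕜`-vector space
(equivalently, isomorphic to `𝕜` as an `A`-module), where `𝕜` is the residue field. -/
def IsCanonicalModule (A : Type) [CommRing A] [IsLocalRing A] (d : ℕ)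
    (ω : ModuleCat A) : Prop :=
  Module.Finite A ω ∧
  (∀ i : ℕ, i ≠ d → Subsingleton
    (((Ext A (ModuleCat A) i).obj
      (op (ModuleCat.of A (IsLocalRing.ResidueField A)))).obj ω)) ∧
  Nonempty ((((Ext A (ModuleCat A) d).obj
      (op (ModuleCat.of A (IsLocalRing.ResidueField A)))).obj ω)
    ≃ₗ[A] IsLocalRing.ResidueField A)

variable (𝕜 : Type) [Field 𝕜] (m n : ℕ)

/-- The formal power series ring `P` in the entries of an `m × n` matrix of variables. -/
abbrev DetP := MvPowerSeries (Fin m × Fin n) 𝕜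

/-- The ideal of `P` generated by the `2 × 2` minors of the matrix of variables. -/
def detI2 : Ideal (DetP 𝕜 m n) :=
  Ideal.span {f | ∃ (i k : Fin m) (j l : Fin n), i < k ∧ j < l ∧
    f = X (i, j) * X (k, l) - X (i, l) * X (k, j)}

/-- The complete determinantal ring `R = P/I₂(X)`. -/
abbrev DetR := DetP 𝕜 m n ⧸ detI2 𝕜 m n

/-- The residue class in `R` of the variable `x_{ij}`. -/
def detx (i : Fin m) (j : Fin n) : DetR 𝕜 m n :=
  Ideal.Quotient.mk (detI2 𝕜 m n) (X (i, j))

/-- The ideal `I` of `R` generated by the entries of the first `n - 1` columns. -/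
def detJ : Ideal (DetR 𝕜 m n) :=
  Ideal.span {x | ∃ (i : Fin m) (j : Fin n), (j : ℕ) < n - 1 ∧ x = detx 𝕜 m n i j}

/-- The formal power series ring `S = 𝕜[[x_1, …, x_m, a_1, …, a_{n-1}]]`. -/
abbrev DetS := MvPowerSeries (Fin m ⊕ Fin (n - 1)) 𝕜

/-- The ideal `𝔞 = (a_1, …, a_{n-1})S`. -/
def detA : Ideal (DetS 𝕜 m n) :=
  Ideal.span {f | ∃ j : Fin (n - 1), f = X (Sum.inr j)}

/-- The property pinning down the local `𝕜`-algebra homomorphism `φ : R → S`: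
`x_{ij} ↦ a_j·x_i` for `1 ≤ j ≤ n-1` and `x_{in} ↦ x_i` (in `0`-based indexing, the last
column is `j = n-1`).  Any `𝕜`-algebra homomorphism `R → S` with these values on the
variables automatically maps the maximal ideal into the maximal ideal, hence is continuous
and is uniquely determined by these values; so this predicate characterizes `φ`. -/
def IsDetPhi (φ : DetR 𝕜 m n →ₐ[𝕜] DetS 𝕜 m n) : Prop :=
  ∀ (i : Fin m) (j : Fin n),
    φ (detx 𝕜 m n i j) =
      if h : (j : ℕ) < n - 1 then X (Sum.inr (⟨j, h⟩ : Fin (n - 1))) * X (Sum.inl i)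
      else X (Sum.inl i)

section ExtComparison
variable {R : Type} [CommRing R]

/-- The degree `n` cocycles of `Hom(P, Y)` for a projective resolution `P`. -/
def extCocycles {X : ModuleCat.{0} R} (P : ProjectiveResolution X) (Y : ModuleCat.{0} R) (n : ℕ) :
    Submodule R (P.complex.X n ⟶ Y) where
  carrier := {f | P.complex.d (n + 1) n ≫ f = 0}
  add_mem' := fun {a b} ha hb => by simp_all
  zero_mem' := by simp
  smul_mem' := fun r f hf => by simp_all

lemma mem_extCocycles {X : ModuleCat.{0} R} {P : ProjectiveResolution X} {Y : ModuleCat.{0} R}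
    {n : ℕ} {f : P.complex.X n ⟶ Y} :
    f ∈ extCocycles P Y n ↔ P.complex.d (n + 1) n ≫ f = 0 := Iff.rfl

lemma extMk_smul {X : ModuleCat.{0} R} (P : ProjectiveResolution X) {Y : ModuleCat.{0} R} {n : ℕ}
    (r : R) (f : P.complex.X n ⟶ Y) (hf : P.complex.d (n + 1) n ≫ f = 0) :
    P.extMk (r • f) (n + 1) rfl (by simp [hf]) = r • P.extMk f (n + 1) rfl hf := by
  rw [Abelian.Ext.smul_eq_comp_mk₀, P.extMk_comp_mk₀]
  simp

/-- The class of a cocycle in `Abelian.Ext`. -/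
def extCocyclesToExt {X : ModuleCat.{0} R} (P : ProjectiveResolution X) (Y : ModuleCat.{0} R)
    (n : ℕ) : extCocycles P Y n →ₗ[R] Abelian.Ext X Y n where
  toFun f := P.extMk f.1 (n + 1) rfl f.2
  map_add' f g := (P.add_extMk _ _ _ _ f.2 g.2).symm
  map_smul' r f := extMk_smul P r f.1 f.2

lemma extCocyclesToExt_surjective {X : ModuleCat.{0} R} (P : ProjectiveResolution X)
    (Y : ModuleCat.{0} R) (n : ℕ) : Function.Surjective (extCocyclesToExt P Y n) := fun α => by
  obtain ⟨f, hf, h⟩ := P.extMk_surjective α (n + 1) rfl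
  exact ⟨⟨f, hf⟩, h⟩

/-- The inclusion of cocycles. -/
def extCocyclesι {X : ModuleCat.{0} R} (P : ProjectiveResolution X) (Y : ModuleCat.{0} R) (n : ℕ) :
    ModuleCat.of R (extCocycles P Y n) ⟶ (P.complex.linearYonedaObj R Y).X n :=
  ModuleCat.ofHom (extCocycles P Y n).subtype

lemma extCocyclesι_d {X : ModuleCat.{0} R} (P : ProjectiveResolution X) (Y : ModuleCat.{0} R)
    (n : ℕ) : extCocyclesι P Y n ≫ (P.complex.linearYonedaObj R Y).d n (n + 1) = 0 := by
  ext f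
  exact f.2

/-- The cocycles, mapped to the cycles of the Hom complex. -/
def extCocyclesToCycles {X : ModuleCat.{0} R} (P : ProjectiveResolution X) (Y : ModuleCat.{0} R)
    (n : ℕ) : ModuleCat.of R (extCocycles P Y n) ⟶ (P.complex.linearYonedaObj R Y).cycles n :=
  (P.complex.linearYonedaObj R Y).liftCycles (extCocyclesι P Y n) (n + 1) (by simp)
    (extCocyclesι_d P Y n)

/-- The class of a cocycle in the derived functor `Ext`. -/
def extCocyclesToDerived {X : ModuleCat.{0} R} (P : ProjectiveResolution X) (Y : ModuleCat.{0} R)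
    (n : ℕ) : ModuleCat.of R (extCocycles P Y n) ⟶ ((Ext R (ModuleCat R) n).obj (op X)).obj Y :=
  extCocyclesToCycles P Y n ≫ (P.complex.linearYonedaObj R Y).homologyπ n ≫ (P.isoExt n Y).inv

lemma extCocyclesToCycles_surjective {X : ModuleCat.{0} R} (P : ProjectiveResolution X)
    (Y : ModuleCat.{0} R) (n : ℕ) : Function.Surjective (extCocyclesToCycles P Y n) := by
  intro z
  refine ⟨⟨(P.complex.linearYonedaObj R Y).iCycles n z, ?_⟩, ?_⟩
  · have := ConcreteCategory.congr_hom ((P.complex.linearYonedaObj R Y).iCycles_d n (n + 1)) z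
    exact this
  · apply (ModuleCat.mono_iff_injective ((P.complex.linearYonedaObj R Y).iCycles n)).1
      inferInstance
    have := (P.complex.linearYonedaObj R Y).liftCycles_i (extCocyclesι P Y n) (n + 1) (by simp)
      (extCocyclesι_d P Y n)
    exact ConcreteCategory.congr_hom this _

lemma extCocyclesToDerived_surjective {X : ModuleCat.{0} R} (P : ProjectiveResolution X)
    (Y : ModuleCat.{0} R) (n : ℕ) : Function.Surjective (extCocyclesToDerived P Y n) := by
  have h1 := (ModuleCat.epi_iff_surjective
    ((P.complex.linearYonedaObj R Y).homologyπ n ≫ (P.isoExt n Y).inv)).1 inferInstance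
  exact h1.comp (extCocyclesToCycles_surjective P Y n)

lemma extCocyclesToDerived_eq_zero_iff {X : ModuleCat.{0} R} (P : ProjectiveResolution X)
    (Y : ModuleCat.{0} R) (n : ℕ) (f : extCocycles P Y n) :
    extCocyclesToDerived P Y n f = 0 ↔
      ∃ g : P.complex.X (n - 1) ⟶ Y, P.complex.d n (n - 1) ≫ g = f.1 := by
  have e1 : (extCocyclesToDerived P Y n f = 0) ↔
      (P.complex.linearYonedaObj R Y).homologyπ n (extCocyclesToCycles P Y n f) = 0 := by
    have := (ModuleCat.mono_iff_injective (P.isoExt (R := R) n Y).inv).1 inferInstance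
    rw [← map_eq_zero_iff (P.isoExt n Y).inv.hom this]
    rfl
  have inj := (ModuleCat.mono_iff_injective ((P.complex.linearYonedaObj R Y).iCycles n)).1
      inferInstance
  have hi : (P.complex.linearYonedaObj R Y).iCycles n (extCocyclesToCycles P Y n f) = f.1 := by
    have := (P.complex.linearYonedaObj R Y).liftCycles_i (extCocyclesι P Y n) (n + 1) (by simp)
      (extCocyclesι_d P Y n)
    exact ConcreteCategory.congr_hom this _
  have hp : (ComplexShape.up ℕ).prev n = n - 1 := by cases n <;> simp
  have ht (y) := ConcreteCategory.congr_hom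
    ((P.complex.linearYonedaObj R Y).toCycles_i (n - 1) n) y
  rw [e1]
  constructor
  · intro h
    have ex := ShortComplex.exact_of_g_is_cokernel
      (ShortComplex.mk _ _ ((P.complex.linearYonedaObj R Y).toCycles_comp_homologyπ (n - 1) n))
      ((P.complex.linearYonedaObj R Y).homologyIsCokernel _ n hp)
    rw [ShortComplex.moduleCat_exact_iff] at ex
    obtain ⟨y, hy⟩ := ex _ h
    refine ⟨y, ?_⟩
    rw [← hi, ← hy]
    exact (ht y).symm
  · rintro ⟨g, hg⟩
    have : extCocyclesToCycles P Y n f =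
        (P.complex.linearYonedaObj R Y).toCycles (n - 1) n g := by
      apply inj
      rw [hi, ← hg]
      exact (ht g).symm
    rw [this]
    exact ConcreteCategory.congr_hom
      ((P.complex.linearYonedaObj R Y).toCycles_comp_homologyπ (n - 1) n) g

lemma extCocyclesToExt_eq_zero_iff {X : ModuleCat.{0} R} (P : ProjectiveResolution X)
    (Y : ModuleCat.{0} R) (n : ℕ) (f : extCocycles P Y n) :
    extCocyclesToExt P Y n f = 0 ↔
      ∃ g : P.complex.X (n - 1) ⟶ Y, P.complex.d n (n - 1) ≫ g = f.1 := by
  cases n with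
  | succ p => exact P.extMk_eq_zero_iff f.1 _ rfl f.2 p rfl
  | zero =>
    have : P.complex.d 0 (0 - 1) = 0 := P.complex.shape _ _ (by simp)
    rw [this]
    simp only [Limits.zero_comp, exists_const]
    constructor
    · intro h
      have h2 := P.extEquivCohomologyClass_extMk f.1 1 rfl f.2
      change P.extMk f.1 1 rfl f.2 = 0 at h
      rw [h, P.extEquivCohomologyClass_zero, eq_comm,
        CochainComplex.HomComplex.CohomologyClass.mk_eq_zero_iff,
        CochainComplex.HomComplex.Cocycle.toSingleMk_mem_coboundaries_iff _ _ _ _ _ 1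
          (by lia)] at h2
      obtain ⟨g, hg⟩ := h2
      have hz : P.cochainComplex.d (-(0:ℕ)) 1 = 0 :=
        (P.cochainComplex.isZero_of_isStrictlyLE 0 1 (by lia)).eq_of_tgt _ _
      rw [hz, Limits.zero_comp] at hg
      have := congrArg (fun t => (P.cochainComplexXIso (-(0:ℕ)) 0 rfl).inv ≫ t) hg
      simpa using this
    · intro h
      have : f = 0 := by ext1; exact h.symm
      rw [this, map_zero]

/-- The derived functor `Ext` agrees with `Abelian.Ext`. -/
def derivedExtEquiv (X Y : ModuleCat.{0} R) (n : ℕ) :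
    ((Ext R (ModuleCat R) n).obj (op X)).obj Y ≃ₗ[R] Abelian.Ext X Y n :=
  let P := projectiveResolution X
  have h : LinearMap.ker (extCocyclesToDerived P Y n).hom =
      LinearMap.ker (extCocyclesToExt P Y n) :=
    by
      ext f
      rw [LinearMap.mem_ker, LinearMap.mem_ker, extCocyclesToExt_eq_zero_iff]
      exact extCocyclesToDerived_eq_zero_iff P Y n f
  ((extCocyclesToDerived P Y n).hom.quotKerEquivOfSurjective
    (extCocyclesToDerived_surjective P Y n)).symm ≪≫ₗ
    Submodule.quotEquivOfEq _ _ h ≪≫ₗ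
    (extCocyclesToExt P Y n).quotKerEquivOfSurjective (extCocyclesToExt_surjective P Y n)

lemma derivedExtEquiv_extCocyclesToDerived (X Y : ModuleCat.{0} R) (n : ℕ)
    (f : extCocycles (projectiveResolution X) Y n) :
    derivedExtEquiv X Y n (extCocyclesToDerived (projectiveResolution X) Y n f) =
      extCocyclesToExt (projectiveResolution X) Y n f := by
  have : ((extCocyclesToDerived (projectiveResolution X) Y n).hom.quotKerEquivOfSurjective
    (extCocyclesToDerived_surjective (projectiveResolution X) Y n)).symm
      (extCocyclesToDerived (projectiveResolution X) Y n f) = Submodule.Quotient.mk f := by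
    rw [LinearEquiv.symm_apply_eq]
    rfl
  simp only [derivedExtEquiv, LinearEquiv.trans_apply]
  rw [this]
  rfl

lemma homologyUnop_hom_naturality
    {K L : HomologicalComplex (ModuleCat.{0} R)ᵒᵖ (ComplexShape.down ℕ)}
    (ψ : K ⟶ L) (n : ℕ) :
    (L.homologyUnop n).hom ≫ (HomologicalComplex.homologyMap ψ n).unop =
      HomologicalComplex.homologyMap
        ((HomologicalComplex.unopFunctor (ModuleCat.{0} R) _).map ψ.op) n ≫
        (K.homologyUnop n).hom := by
  apply Quiver.Hom.op_inj
  exact HomologicalComplex.homologyOp_hom_naturality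
    ((HomologicalComplex.unopFunctor (ModuleCat.{0} R) _).map ψ.op) n

lemma isoExt_inv_naturality {X X' Y : ModuleCat.{0} R} (g : X' ⟶ X) (n : ℕ)
    (P : ProjectiveResolution X) (P' : ProjectiveResolution X')
    (φ : ProjectiveResolution.Hom P' P g) :
    (P.isoExt (R := R) n Y).inv ≫ ((Ext R (ModuleCat R) n).map g.op).app Y =
      HomologicalComplex.homologyMap ((HomologicalComplex.unopFunctor (ModuleCat.{0} R) _).map
        ((((linearYoneda R (ModuleCat.{0} R)).obj Y).rightOp.mapHomologicalComplex _).map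
          φ.hom).op) n ≫ (P'.isoExt (R := R) n Y).inv := by
  have h1 := P'.isoLeftDerivedObj_hom_naturality g P φ.hom
    (by simpa using φ.hom_f_zero_comp_π_f_zero)
    ((linearYoneda R (ModuleCat.{0} R)).obj Y).rightOp n
  have h2 := homologyUnop_hom_naturality
    ((((linearYoneda R (ModuleCat.{0} R)).obj Y).rightOp.mapHomologicalComplex
      (ComplexShape.down ℕ)).map φ.hom) n
  have h1' := congrArg Quiver.Hom.unop h1
  have e1 (Q : ModuleCat.{0} R) (P : ProjectiveResolution Q) : (P.isoExt (R := R) n Y).inv =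
    (HomologicalComplex.homologyUnop ((((linearYoneda R (ModuleCat.{0} R)).obj
      Y).rightOp.mapHomologicalComplex (ComplexShape.down ℕ)).obj P.complex) n).hom ≫
    (P.isoLeftDerivedObj ((linearYoneda R (ModuleCat.{0} R)).obj Y).rightOp n).hom.unop := rfl
  rw [e1, e1]
  refine (Category.assoc _ _ _).trans ?_
  refine (congrArg _ h1').trans ?_
  refine (Category.assoc _ _ _).symm.trans ?_
  refine (congrArg (· ≫ _) h2).trans ?_
  exact Category.assoc _ _ _

lemma extCocyclesToDerived_naturality {X X' Y : ModuleCat.{0} R} (g : X' ⟶ X) (n : ℕ)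
    (P : ProjectiveResolution X) (P' : ProjectiveResolution X')
    (φ : ProjectiveResolution.Hom P' P g) (f : extCocycles P Y n) :
    (((Ext R (ModuleCat R) n).map g.op).app Y) (extCocyclesToDerived P Y n f) =
      extCocyclesToDerived P' Y n ⟨φ.hom.f n ≫ f.1, by
        rw [mem_extCocycles, ← φ.hom.comm_assoc, f.2, Limits.comp_zero]⟩ := by
  have h1 := isoExt_inv_naturality (Y := Y) g n P P' φ
  set ψ := (HomologicalComplex.unopFunctor (ModuleCat.{0} R) _).map
        ((((linearYoneda R (ModuleCat.{0} R)).obj Y).rightOp.mapHomologicalComplex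
          (ComplexShape.down ℕ)).map φ.hom).op with hψ
  have h2 := HomologicalComplex.homologyπ_naturality ψ n
  let f' : extCocycles P' Y n := ⟨φ.hom.f n ≫ f.1, by
        rw [mem_extCocycles, ← φ.hom.comm_assoc, f.2, Limits.comp_zero]⟩
  have h3 : HomologicalComplex.cyclesMap ψ n (extCocyclesToCycles P Y n f) =
      extCocyclesToCycles P' Y n f' := by
    apply (ModuleCat.mono_iff_injective ((P'.complex.linearYonedaObj R Y).iCycles n)).1
      inferInstance
    have a1 := ConcreteCategory.congr_hom (HomologicalComplex.cyclesMap_i ψ n)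
      (extCocyclesToCycles P Y n f)
    have a2 := ConcreteCategory.congr_hom ((P.complex.linearYonedaObj R Y).liftCycles_i
      (extCocyclesι P Y n) (n + 1) (by simp) (extCocyclesι_d P Y n)) f
    have a3 := ConcreteCategory.congr_hom ((P'.complex.linearYonedaObj R Y).liftCycles_i
      (extCocyclesι P' Y n) (n + 1) (by simp) (extCocyclesι_d P' Y n)) f'
    refine a1.trans (Eq.trans ?_ a3.symm)
    exact congrArg (ψ.f n) a2
  have b1 := ConcreteCategory.congr_hom h1
    ((P.complex.linearYonedaObj R Y).homologyπ n (extCocyclesToCycles P Y n f))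
  have b2 := ConcreteCategory.congr_hom h2 (extCocyclesToCycles P Y n f)
  refine b1.trans ?_
  change (P'.isoExt n Y).inv (HomologicalComplex.homologyMap ψ n
    ((P.complex.linearYonedaObj R Y).homologyπ n (extCocyclesToCycles P Y n f))) = _
  refine (congrArg (P'.isoExt n Y).inv b2).trans ?_
  change (P'.isoExt n Y).inv ((P'.complex.linearYonedaObj R Y).homologyπ n
    (HomologicalComplex.cyclesMap ψ n (extCocyclesToCycles P Y n f))) = _
  rw [h3]
  rfl

lemma derivedExtEquiv_naturality {X X' Y : ModuleCat.{0} R} (g : X' ⟶ X) (n : ℕ)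
    (a : ((Ext R (ModuleCat R) n).obj (op X)).obj Y) :
    derivedExtEquiv X' Y n ((((Ext R (ModuleCat R) n).map g.op).app Y) a) =
      (Abelian.Ext.mk₀ g).comp (derivedExtEquiv X Y n a) (zero_add n) := by
  obtain ⟨f, rfl⟩ := extCocyclesToDerived_surjective (projectiveResolution X) Y n a
  let φ : ProjectiveResolution.Hom (projectiveResolution X') (projectiveResolution X) g :=
    { hom := ProjectiveResolution.lift g _ _
      hom_f_zero_comp_π_f_zero := ProjectiveResolution.lift_commutes_zero g _ _ }
  rw [extCocyclesToDerived_naturality g n _ _ φ, derivedExtEquiv_extCocyclesToDerived,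
    derivedExtEquiv_extCocyclesToDerived]
  exact (ProjectiveResolution.mk₀_comp_extMk f.1 _ rfl f.2 φ).symm

end ExtComparison

section LocalCohomologyElements
variable {R : Type} [CommRing R]

/-- The projection `R/J^t → R/J^s` for `s ≤ t`. -/
def powQuotMap (J : Ideal R) {s t : ℕ} (h : s ≤ t) :
    ModuleCat.of R (R ⧸ J ^ t) ⟶ ModuleCat.of R (R ⧸ J ^ s) :=
  ModuleCat.ofHom <| Submodule.mapQ _ _ LinearMap.id (Ideal.pow_le_pow_right h)

/-- The structure map to local cohomology, from the derived functor `Ext`. -/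
def derivedLocalCohomologyι (J : Ideal R) (n : ℕ) (Y : ModuleCat.{0} R) (t : ℕ) :
    ((Ext R (ModuleCat R) n).obj (op (ModuleCat.of R (R ⧸ J ^ t)))).obj Y ⟶
      (localCohomology J n).obj Y :=
  (Limits.colimit.ι (localCohomology.diagram (localCohomology.idealPowersDiagram J) n)
    (op (op t))).app Y

/-- The structure map `Ext^n(R/J^t, Y) → H^n_J(Y)`. -/
def localCohomologyι (J : Ideal R) (n : ℕ) (Y : ModuleCat.{0} R) (t : ℕ) :
    Abelian.Ext (ModuleCat.of R (R ⧸ J ^ t)) Y n →ₗ[R] (localCohomology J n).obj Y :=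
  (derivedLocalCohomologyι J n Y t).hom ∘ₗ
    (derivedExtEquiv (ModuleCat.of R (R ⧸ J ^ t)) Y n).symm.toLinearMap

lemma localCohomologyι_derivedExtEquiv (J : Ideal R) (n : ℕ) (Y : ModuleCat.{0} R) (t : ℕ)
    (a : ((Ext R (ModuleCat R) n).obj (op (ModuleCat.of R (R ⧸ J ^ t)))).obj Y) :
    localCohomologyι J n Y t (derivedExtEquiv _ Y n a) = derivedLocalCohomologyι J n Y t a := by
  rw [localCohomologyι, LinearMap.comp_apply, LinearEquiv.coe_coe, LinearEquiv.symm_apply_apply]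

/-- The colimit cocone computing local cohomology, evaluated at a module. -/
def localCohomologyCocone (J : Ideal R) (n : ℕ) (Y : ModuleCat.{0} R) :
    Limits.Cocone (localCohomology.diagram (localCohomology.idealPowersDiagram J) n ⋙
      (evaluation (ModuleCat.{0} R) (ModuleCat.{0} R)).obj Y) :=
  ((evaluation (ModuleCat.{0} R) (ModuleCat.{0} R)).obj Y).mapCocone
    (Limits.colimit.cocone (localCohomology.diagram (localCohomology.idealPowersDiagram J) n))

/-- Evaluation of the colimit defining local cohomology is a colimit. -/
def localCohomologyIsColimit (J : Ideal R) (n : ℕ) (Y : ModuleCat.{0} R) :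
    Limits.IsColimit (localCohomologyCocone J n Y) :=
  Limits.isColimitOfPreserves _ (Limits.colimit.isColimit _)

lemma localCohomologyι_exists_rep (J : Ideal R) (n : ℕ) (Y : ModuleCat.{0} R)
    (x : (localCohomology J n).obj Y) : ∃ t e, localCohomologyι J n Y t e = x := by
  obtain ⟨t, e, h⟩ := Limits.Concrete.isColimit_exists_rep _ (localCohomologyIsColimit J n Y) x
  refine ⟨t.unop.unop, derivedExtEquiv _ Y n e, ?_⟩
  rw [← h]
  exact localCohomologyι_derivedExtEquiv J n Y _ e

lemma localCohomologyι_powQuotMap (J : Ideal R) (n : ℕ) (Y : ModuleCat.{0} R) {s t : ℕ}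
    (h : s ≤ t) (e : Abelian.Ext (ModuleCat.of R (R ⧸ J ^ s)) Y n) :
    localCohomologyι J n Y t ((Abelian.Ext.mk₀ (powQuotMap J h)).comp e (zero_add n)) =
      localCohomologyι J n Y s e := by
  obtain ⟨a, rfl⟩ := (derivedExtEquiv _ Y n).surjective e
  rw [← derivedExtEquiv_naturality, localCohomologyι_derivedExtEquiv,
    localCohomologyι_derivedExtEquiv]
  let w : (op (op s) : ℕᵒᵖᵒᵖ) ⟶ op (op t) := (homOfLE h).op.op
  have := NatTrans.congr_app (Limits.colimit.w
    (localCohomology.diagram (localCohomology.idealPowersDiagram J) n) w) Y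
  exact ConcreteCategory.congr_hom this a

lemma localCohomologyι_eq_zero (J : Ideal R) (n : ℕ) (Y : ModuleCat.{0} R) {s : ℕ}
    (e : Abelian.Ext (ModuleCat.of R (R ⧸ J ^ s)) Y n) (h0 : localCohomologyι J n Y s e = 0) :
    ∃ t, ∃ h : s ≤ t, (Abelian.Ext.mk₀ (powQuotMap J h)).comp e (zero_add n) = 0 := by
  obtain ⟨a, rfl⟩ := (derivedExtEquiv _ Y n).surjective e
  have h0' : (localCohomologyCocone J n Y).ι.app (op (op s)) a =
      (localCohomologyCocone J n Y).ι.app (op (op s)) 0 := by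
    rw [localCohomologyι_derivedExtEquiv] at h0
    rw [map_zero]
    exact h0
  obtain ⟨k, f, g, hk⟩ := Limits.Concrete.isColimit_exists_of_rep_eq _
    (localCohomologyIsColimit J n Y) (i := op (op s)) (j := op (op s)) a 0 h0'
  refine ⟨k.unop.unop, leOfHom f.unop.unop, ?_⟩
  rw [← derivedExtEquiv_naturality]
  rw [map_zero] at hk
  refine (congrArg _ ?_).trans (map_zero _)
  exact hk

end LocalCohomologyElements

section ExtLinear
variable (R : Type) [CommRing R]

/-- The `R`-module `Ext^n_R(M, Y)`, for unbundled modules. -/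
abbrev ExtMod (M Y : Type) [AddCommGroup M] [Module R M] [AddCommGroup Y] [Module R Y] (n : ℕ) :
    Type :=
  Abelian.Ext (ModuleCat.of R M) (ModuleCat.of R Y) n

variable {R}
variable {M M' M'' : Type} [AddCommGroup M] [Module R M] [AddCommGroup M'] [Module R M']
  [AddCommGroup M''] [Module R M''] (Y : Type) [AddCommGroup Y] [Module R Y]

/-- The map induced on `Ext` by a linear map in the first variable. -/
def extPre (f : M →ₗ[R] M') (n : ℕ) : ExtMod R M' Y n →ₗ[R] ExtMod R M Y n :=
  (Abelian.Ext.mk₀ (ModuleCat.ofHom f)).precompOfLinear R (ModuleCat.of R Y) (zero_add n)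

lemma extPre_apply (f : M →ₗ[R] M') (n : ℕ) (e : ExtMod R M' Y n) :
    extPre Y f n e = (Abelian.Ext.mk₀ (ModuleCat.ofHom f)).comp e (zero_add n) := rfl

lemma extPre_comp (g : M' →ₗ[R] M'') (f : M →ₗ[R] M') (n : ℕ) (e : ExtMod R M'' Y n) :
    extPre Y (g ∘ₗ f) n e = extPre Y f n (extPre Y g n e) := by
  simp only [extPre_apply, Abelian.Ext.mk₀_comp_mk₀_assoc, ModuleCat.ofHom_comp]

lemma extPre_id (n : ℕ) (e : ExtMod R M Y n) : extPre Y LinearMap.id n e = e := by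
  simp only [extPre_apply, ModuleCat.ofHom_id, Abelian.Ext.mk₀_id_comp]

lemma extPre_smul (r : R) (f : M →ₗ[R] M') (n : ℕ) (e : ExtMod R M' Y n) :
    extPre Y (r • f) n e = r • extPre Y f n e := by
  have : ModuleCat.ofHom (r • f) = r • ModuleCat.ofHom f := rfl
  simp only [extPre_apply, this, Abelian.Ext.mk₀_smul, Abelian.Ext.smul_comp]

lemma extPre_zero (n : ℕ) (e : ExtMod R M' Y n) :
    extPre Y (0 : M →ₗ[R] M') n e = 0 := by
  have : ModuleCat.ofHom (0 : M →ₗ[R] M') = 0 := rfl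
  simp only [extPre_apply, this, Abelian.Ext.mk₀_zero, Abelian.Ext.zero_comp]

/-- A linear equivalence induces a linear equivalence on `Ext` in the first variable. -/
def extPreEquiv (f : M ≃ₗ[R] M') (n : ℕ) : ExtMod R M' Y n ≃ₗ[R] ExtMod R M Y n :=
  LinearEquiv.ofLinearMap (extPre Y f.toLinearMap n) (extPre Y f.symm.toLinearMap n)
    (by ext e; simp [← extPre_comp, extPre_id])
    (by ext e; simp [← extPre_comp, extPre_id])

variable {Y}

lemma smul_extMod_eq_zero {r : R} (hr : ∀ x : M, r • x = 0) (n : ℕ) (e : ExtMod R M Y n) :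
    r • e = 0 := by
  rw [← extPre_id Y n e, ← extPre_smul]
  have : r • (LinearMap.id : M →ₗ[R] M) = 0 := by ext x; simpa using hr x
  rw [this, extPre_zero]

lemma subsingleton_extMod_of_subsingleton [Subsingleton M] (n : ℕ) :
    Subsingleton (ExtMod R M Y n) :=
  ⟨fun a b ↦ by
    rw [← extPre_id Y n a, ← extPre_id Y n b]
    have : (LinearMap.id : M →ₗ[R] M) = 0 := by ext x; exact Subsingleton.elim _ _
    rw [this, extPre_zero, extPre_zero]⟩

/-- `Ext` in degree zero is `Hom`. -/
def extZeroEquiv (M Y : Type) [AddCommGroup M] [Module R M] [AddCommGroup Y] [Module R Y] :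
    ExtMod R M Y 0 ≃ₗ[R] (M →ₗ[R] Y) :=
  Abelian.Ext.linearEquiv₀.trans ModuleCat.homLinearEquiv

section LongExact

lemma shortExact_of_linearMap {f : M →ₗ[R] M'} {g : M' →ₗ[R] M''} (hf : Function.Injective f)
    (hfg : Function.Exact f g) (hg : Function.Surjective g) :
    (ShortComplex.mk (ModuleCat.ofHom f) (ModuleCat.ofHom g)
      (by ext x; simpa using hfg.apply_apply_eq_zero x)).ShortExact where
  exact := (ShortComplex.ShortExact.moduleCat_exact_iff_function_exact _).mpr hfg
  mono_f := (ModuleCat.mono_iff_injective _).mpr hf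
  epi_g := (ModuleCat.epi_iff_surjective _).mpr hg

lemma extPre_exact (Y : Type) [AddCommGroup Y] [Module R Y]
    {f : M →ₗ[R] M'} {g : M' →ₗ[R] M''} (hf : Function.Injective f)
    (hfg : Function.Exact f g) (hg : Function.Surjective g) (n : ℕ) :
    Function.Exact (extPre Y g n) (extPre Y f n) := by
  intro x
  refine ⟨fun h ↦ ?_, ?_⟩
  · exact Abelian.Ext.contravariant_sequence_exact₂ (shortExact_of_linearMap hf hfg hg) _ x h
  · rintro ⟨y, rfl⟩
    rw [← extPre_comp, hfg.linearMap_comp_eq_zero, extPre_zero]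

lemma extPre_injective_zero (Y : Type) [AddCommGroup Y] [Module R Y]
    {g : M' →ₗ[R] M''} (hg : Function.Surjective g) :
    Function.Injective (extPre Y g 0) := by
  have : Epi (ModuleCat.ofHom g) := (ModuleCat.epi_iff_surjective _).mpr hg
  exact Abelian.Ext.precomp_mk₀_injective_of_epi _ (ModuleCat.ofHom g)

lemma exists_extPre_connecting (Y : Type) [AddCommGroup Y] [Module R Y]
    {f : M →ₗ[R] M'} {g : M' →ₗ[R] M''} (hf : Function.Injective f)
    (hfg : Function.Exact f g) (hg : Function.Surjective g) (n : ℕ) :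
    ∃ δ : ExtMod R M Y n →ₗ[R] ExtMod R M'' Y (n + 1),
      Function.Exact (extPre Y f n) δ ∧ Function.Exact δ (extPre Y g (n + 1)) := by
  have hS := shortExact_of_linearMap hf hfg hg
  refine ⟨hS.extClass.precompOfLinear R (ModuleCat.of R Y) (add_comm 1 n), ?_, ?_⟩
  · intro x
    refine ⟨fun h ↦ Abelian.Ext.contravariant_sequence_exact₁ hS _ x (add_comm 1 n) h, ?_⟩
    rintro ⟨y, rfl⟩
    exact hS.extClass_comp_assoc y (h := add_comm 1 n)
  · intro x
    refine ⟨fun h ↦ Abelian.Ext.contravariant_sequence_exact₃ hS _ x h (add_comm 1 n), ?_⟩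
    rintro ⟨y, rfl⟩
    exact hS.comp_extClass_assoc y (add_comm 1 n)

/-- The map induced on `Ext` by a linear map in the second variable. -/
def extPost (X : Type) [AddCommGroup X] [Module R X] (f : M →ₗ[R] M') (n : ℕ) :
    ExtMod R X M n →ₗ[R] ExtMod R X M' n :=
  (Abelian.Ext.mk₀ (ModuleCat.ofHom f)).postcompOfLinear R (ModuleCat.of R X) (add_zero n)

lemma extPost_apply (X : Type) [AddCommGroup X] [Module R X] (f : M →ₗ[R] M') (n : ℕ)
    (e : ExtMod R X M n) :
    extPost X f n e = e.comp (Abelian.Ext.mk₀ (ModuleCat.ofHom f)) (add_zero n) := rfl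

lemma extPost_smul_id (X : Type) [AddCommGroup X] [Module R X] (r : R) (n : ℕ)
    (e : ExtMod R X M n) : extPost X (r • (LinearMap.id : M →ₗ[R] M)) n e = r • e := by
  have : ModuleCat.ofHom (r • (LinearMap.id : M →ₗ[R] M)) = r • 𝟙 (ModuleCat.of R M) := rfl
  rw [extPost_apply, this, ← Abelian.Ext.smul_eq_comp_mk₀]

lemma extPost_injective_zero (X : Type) [AddCommGroup X] [Module R X]
    {f : M →ₗ[R] M'} (hf : Function.Injective f) :
    Function.Injective (extPost X f 0) := by
  have : Mono (ModuleCat.ofHom f) := (ModuleCat.mono_iff_injective _).mpr hf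
  exact Abelian.Ext.postcomp_mk₀_injective_of_mono _ (ModuleCat.ofHom f)

lemma exists_extPost_connecting (X : Type) [AddCommGroup X] [Module R X]
    {f : M →ₗ[R] M'} {g : M' →ₗ[R] M''} (hf : Function.Injective f)
    (hfg : Function.Exact f g) (hg : Function.Surjective g) (n : ℕ) :
    ∃ δ : ExtMod R X M'' n →ₗ[R] ExtMod R X M (n + 1),
      Function.Exact (extPost X g n) δ ∧ Function.Exact δ (extPost X f (n + 1)) := by
  have hS := shortExact_of_linearMap hf hfg hg
  refine ⟨hS.extClass.postcompOfLinear R (ModuleCat.of R X) rfl, ?_, ?_⟩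
  · intro x
    refine ⟨fun h ↦ Abelian.Ext.covariant_sequence_exact₃ _ hS x rfl h, ?_⟩
    rintro ⟨y, rfl⟩
    change (y.comp (Abelian.Ext.mk₀ (ModuleCat.ofHom g)) (add_zero n)).comp hS.extClass rfl = 0
    rw [Abelian.Ext.comp_assoc_of_second_deg_zero]
    erw [hS.comp_extClass]
    exact Abelian.Ext.comp_zero ..
  · intro x
    refine ⟨fun h ↦ Abelian.Ext.covariant_sequence_exact₁ _ hS x h rfl, ?_⟩
    rintro ⟨y, rfl⟩
    change (y.comp hS.extClass rfl).comp (Abelian.Ext.mk₀ (ModuleCat.ofHom f)) (add_zero _) = 0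
    rw [Abelian.Ext.comp_assoc_of_third_deg_zero]
    erw [hS.extClass_comp]
    exact Abelian.Ext.comp_zero ..

end LongExact
end ExtLinear

section Devissage
variable {R : Type} [CommRing R]

lemma subsingleton_of_exact {A B C : Type} [AddCommGroup A] [AddCommGroup B] [AddCommGroup C]
    [Module R A] [Module R B] [Module R C] {f : A →ₗ[R] B} {g : B →ₗ[R] C}
    (h : Function.Exact f g) [Subsingleton A] [Subsingleton C] : Subsingleton B := by
  refine subsingleton_of_forall_eq 0 fun b ↦ ?_
  obtain ⟨a, rfl⟩ := (h b).mp (Subsingleton.elim _ _)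
  rw [Subsingleton.elim a 0, map_zero]

lemma subsingleton_extMod_of_pow_smul [IsNoetherianRing R] (𝔪 : Ideal R) [h𝔪 : 𝔪.IsMaximal]
    (Y : Type) [AddCommGroup Y] [Module R Y] (j : ℕ) (h : Subsingleton (ExtMod R (R ⧸ 𝔪) Y j))
    (C : Type) [AddCommGroup C] [Module R C] [Module.Finite R C] (N : ℕ)
    (hN : ∀ r ∈ 𝔪 ^ N, ∀ c : C, r • c = 0) : Subsingleton (ExtMod R C Y j) := by
  revert hN
  induction ‹Module.Finite R C› using
    IsNoetherianRing.induction_on_isQuotientEquivQuotientPrime R with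
  | subsingleton C => exact fun _ ↦ subsingleton_extMod_of_subsingleton j
  | quotient C p f =>
    intro hN
    have hp : 𝔪 = p.1 := by
      refine h𝔪.eq_of_le p.2.ne_top ?_
      refine Ideal.IsPrime.le_of_pow_le (I := 𝔪) (n := N) fun r hr ↦ ?_
      have := hN r hr (f.symm 1)
      rw [← map_smul, LinearEquiv.map_eq_zero_iff] at this
      rwa [Algebra.smul_def, mul_one, Ideal.Quotient.algebraMap_eq,
        Ideal.Quotient.eq_zero_iff_mem] at this
    subst hp
    exact (extPreEquiv Y f.symm j).toEquiv.subsingleton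
  | exact N₁ N₂ N₃ f g hf hg hfg h₁ h₃ =>
    intro hN
    have := h₁ fun r hr c ↦ hf (by rw [map_smul, hN r hr, map_zero])
    have := h₃ fun r hr c ↦ by
      obtain ⟨d, rfl⟩ := hg c
      rw [← map_smul, hN r hr, map_zero]
    exact subsingleton_of_exact (extPre_exact Y hf hfg hg j)

lemma bijective_extPre_of_pow_smul [IsNoetherianRing R] (𝔪 : Ideal R) [h𝔪 : 𝔪.IsMaximal]
    (Y : Type) [AddCommGroup Y] [Module R Y] (j : ℕ)
    (h : ∀ i ≤ j + 1, Subsingleton (ExtMod R (R ⧸ 𝔪) Y i))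
    {M C : Type} [AddCommGroup C] [Module R C] [AddCommGroup M] [Module R M] [Module.Finite R M]
    (f : M →ₗ[R] C) (hfin : Module.Finite R (C ⧸ LinearMap.range f)) (N : ℕ)
    (hker : ∀ r ∈ 𝔪 ^ N, ∀ c ∈ LinearMap.ker f, r • c = 0)
    (hcoker : ∀ r ∈ 𝔪 ^ N, ∀ c : C, r • c ∈ LinearMap.range f) :
    Function.Bijective (extPre Y f j) := by
  have hK (i) (hi : i ≤ j + 1) : Subsingleton (ExtMod R (LinearMap.ker f) Y i) :=
    subsingleton_extMod_of_pow_smul 𝔪 Y i (h i hi) _ N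
      fun r hr c ↦ Subtype.ext (hker r hr c c.2)
  have hQ (i) (hi : i ≤ j + 1) : Subsingleton (ExtMod R (C ⧸ LinearMap.range f) Y i) :=
    subsingleton_extMod_of_pow_smul 𝔪 Y i (h i hi) _ N fun r hr c ↦ by
      obtain ⟨c, rfl⟩ := Submodule.mkQ_surjective _ c
      rw [← map_smul, Submodule.mkQ_apply, Submodule.Quotient.mk_eq_zero]
      exact hcoker r hr c
  have e : f = (LinearMap.range f).subtype ∘ₗ f.rangeRestrict := by ext; rfl
  have e' : ⇑(extPre Y f j) = extPre Y f.rangeRestrict j ∘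
      extPre Y (LinearMap.range f).subtype j := by
    ext x
    conv_lhs => rw [e]
    exact extPre_comp ..
  rw [e']
  have ex1 : Function.Exact (LinearMap.ker f).subtype f.rangeRestrict := by
    intro x; simp [Subtype.ext_iff]
  have ex2 : Function.Exact (LinearMap.range f).subtype (LinearMap.range f).mkQ := by
    intro x; simp
  have s1 := f.surjective_rangeRestrict
  have s2 := (LinearMap.range f).mkQ_surjective
  refine Function.Bijective.comp ⟨?_, ?_⟩ ⟨?_, ?_⟩
  · cases j with
    | zero => exact extPre_injective_zero Y s1
    | succ j =>
      obtain ⟨δ, -, h2⟩ := exists_extPre_connecting Y (Submodule.subtype_injective _) ex1 s1 j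
      rw [injective_iff_map_eq_zero]
      intro a ha
      obtain ⟨b, rfl⟩ := (h2 a).mp ha
      have := hK j (by omega)
      rw [Subsingleton.elim b 0, map_zero]
  · intro x
    have := hK j (by omega)
    exact (extPre_exact Y (Submodule.subtype_injective _) ex1 s1 j x).mp (Subsingleton.elim _ _)
  · rw [injective_iff_map_eq_zero]
    intro a ha
    obtain ⟨b, rfl⟩ := (extPre_exact Y (Submodule.subtype_injective _) ex2 s2 j a).mp ha
    have := hQ j (by omega)
    rw [Subsingleton.elim b 0, map_zero]
  · intro x
    obtain ⟨δ, h1, -⟩ := exists_extPre_connecting Y (Submodule.subtype_injective _) ex2 s2 j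
    have := hQ (j + 1) le_rfl
    exact (h1 x).mp (Subsingleton.elim _ _)

end Devissage

section RegularExt
open scoped Pointwise
variable {R : Type} [CommRing R]

lemma exact_smul_quotSMulTop (r : R) (B : Type) [AddCommGroup B] [Module R B] :
    Function.Exact (r • (LinearMap.id : B →ₗ[R] B))
      (Submodule.mkQ (r • (⊤ : Submodule R B))) := by
  intro x
  simp [Submodule.mem_smul_pointwise_iff_exists]

/-- If `M --r--> M → M' → 0` is exact then `M/rM ≃ M'`. -/
def quotSMulTopEquivOfExact {M M' : Type} [AddCommGroup M] [Module R M] [AddCommGroup M']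
    [Module R M'] (r : R) (δ : M →ₗ[R] M') (hδ : Function.Surjective δ)
    (h : LinearMap.ker δ = r • ⊤) : QuotSMulTop r M ≃ₗ[R] M' :=
  (Submodule.quotEquivOfEq _ _ h.symm).trans (δ.quotKerEquivOfSurjective hδ)

lemma isRegular_extMod_of_quotient [IsNoetherianRing R] [IsLocalRing R]
    (Y : Type) [AddCommGroup Y] [Module R Y] [Module.Finite R Y] (d : ℕ) (rs : List R) :
    ∀ (B : Type) [AddCommGroup B] [Module R B] [Module.Finite R B] (e : ℕ),
      (∀ r ∈ rs, r ∈ IsLocalRing.maximalIdeal R) → RingTheory.Sequence.IsWeaklyRegular B rs →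
      (∀ j ≠ d, Subsingleton (ExtMod R (B ⧸ (Ideal.ofList rs • (⊤ : Submodule R B))) Y j)) →
      Nontrivial (ExtMod R (B ⧸ (Ideal.ofList rs • (⊤ : Submodule R B))) Y d) →
      e + rs.length = d →
      (∀ j ≠ e, Subsingleton (ExtMod R B Y j)) ∧
        RingTheory.Sequence.IsRegular (ExtMod R B Y e) rs := by
  induction rs with
  | nil =>
    rintro B _ _ _ e - - h0 h1 rfl
    have g : B ≃ₗ[R] (B ⧸ (Ideal.ofList [] • (⊤ : Submodule R B))) :=
      (Submodule.quotEquivOfEqBot _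
        ((congrArg (· • ⊤) Ideal.ofList_nil).trans (Submodule.bot_smul _))).symm
    refine ⟨fun j hj ↦ ?_, ?_⟩
    · have := h0 j (by simpa using hj)
      exact (extPreEquiv Y g.symm j).toEquiv.subsingleton
    · have : Nontrivial (ExtMod R B Y e) :=
        (extPreEquiv Y g.symm e).toEquiv.nontrivial
      exact RingTheory.Sequence.IsRegular.nil R _
  | cons r rs ih =>
    rintro B _ _ _ e hrs hB h0 h1 hd
    rw [RingTheory.Sequence.isWeaklyRegular_cons_iff] at hB
    let q := (Submodule.quotOfListConsSMulTopEquivQuotSMulTopInner B r rs)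
    obtain ⟨i0, i1⟩ := ih (QuotSMulTop r B) (e + 1)
      (fun r h ↦ hrs r (List.mem_cons_of_mem _ h)) hB.2
      (fun j hj ↦ have := h0 j hj; (extPreEquiv Y q j).toEquiv.subsingleton)
      (extPreEquiv Y q d).toEquiv.nontrivial (by simp at hd; omega)
    have hr : r ∈ IsLocalRing.maximalIdeal R := hrs r List.mem_cons_self
    have ex := exact_smul_quotSMulTop r B
    have inj : Function.Injective (r • (LinearMap.id : B →ₗ[R] B)) := fun a b h ↦ hB.1 h
    have sur := Submodule.mkQ_surjective (r • (⊤ : Submodule R B))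
    have ev (j) (x : ExtMod R B Y j) :
        extPre Y (r • (LinearMap.id : B →ₗ[R] B)) j x = r • x := by
      rw [extPre_smul, extPre_id]
    have van : ∀ j ≠ e, Subsingleton (ExtMod R B Y j) := by
      intro j hj
      obtain ⟨δ, d1, -⟩ := exists_extPre_connecting Y inj ex sur j
      have : Subsingleton (ExtMod R (B ⧸ (r • (⊤ : Submodule R B))) Y (j + 1)) :=
        i0 (j + 1) (by omega)
      have fin : Module.Finite R (ExtMod R B Y j) := inferInstance
      rw [← Submodule.subsingleton_iff R, ← subsingleton_iff_bot_eq_top, eq_comm]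
      refine Submodule.eq_bot_of_le_smul_of_le_jacobson_bot (IsLocalRing.maximalIdeal R) ⊤
        fin.1 ?_ (IsLocalRing.maximalIdeal_le_jacobson _)
      intro x _
      obtain ⟨y, rfl⟩ := (d1 x).mp (Subsingleton.elim _ _)
      rw [ev]
      exact Submodule.smul_mem_smul hr trivial
    refine ⟨van, ?_⟩
    rw [RingTheory.Sequence.isRegular_cons_iff]
    constructor
    · have hin : Function.Injective (extPre Y (r • (LinearMap.id : B →ₗ[R] B)) e) := by
        rw [injective_iff_map_eq_zero]
        intro a ha
        obtain ⟨b, rfl⟩ := (extPre_exact Y inj ex sur e a).mp ha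
        have : Subsingleton (ExtMod R (B ⧸ (r • (⊤ : Submodule R B))) Y e) := i0 e (by omega)
        rw [Subsingleton.elim b 0, map_zero]
      intro a b hab
      exact hin (by rw [ev, ev]; exact hab)
    · obtain ⟨δ, d1, d2⟩ := exists_extPre_connecting Y inj ex sur e
      refine (LinearEquiv.isRegular_congr (quotSMulTopEquivOfExact r δ ?_ ?_) rs).mpr i1
      · intro x
        have := van (e + 1) (by omega)
        exact (d2 x).mp (Subsingleton.elim _ _)
      · rw [d1.linearMap_ker_eq]
        ext x
        simp only [LinearMap.mem_range, Submodule.mem_smul_pointwise_iff_exists, ev,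
          Submodule.mem_top, true_and]

lemma isRegular_extMod [IsNoetherianRing R] [IsLocalRing R]
    (Y : Type) [AddCommGroup Y] [Module R Y] [Module.Finite R Y] (d : ℕ)
    (h0 : ∀ j ≠ d, Subsingleton (ExtMod R (R ⧸ IsLocalRing.maximalIdeal R) Y j))
    (h1 : Nontrivial (ExtMod R (R ⧸ IsLocalRing.maximalIdeal R) Y d))
    (rs : List R) (hrs : ∀ r ∈ rs, r ∈ IsLocalRing.maximalIdeal R)
    (B : Type) [AddCommGroup B] [Module R B] [Module.Finite R B] [Nontrivial B]
    (hB : RingTheory.Sequence.IsWeaklyRegular B rs)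
    (hrsB : ∀ r ∈ IsLocalRing.maximalIdeal R, ∀ b : B,
      r • b ∈ Ideal.ofList rs • (⊤ : Submodule R B)) (e : ℕ) (he : e + rs.length = d) :
    (∀ j ≠ e, Subsingleton (ExtMod R B Y j)) ∧
      RingTheory.Sequence.IsRegular (ExtMod R B Y e) rs := by
  set K := B ⧸ (Ideal.ofList rs • (⊤ : Submodule R B)) with hK
  have hsmul : ∀ r ∈ IsLocalRing.maximalIdeal R, ∀ x : K, r • x = 0 := by
    intro r hr x
    obtain ⟨x, rfl⟩ := Submodule.mkQ_surjective _ x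
    rw [← map_smul, Submodule.mkQ_apply, Submodule.Quotient.mk_eq_zero]
    exact hrsB r hr x
  refine isRegular_extMod_of_quotient Y d rs B e hrs hB (fun j hj ↦ ?_) ?_ he
  · exact subsingleton_extMod_of_pow_smul (IsLocalRing.maximalIdeal R) Y j (h0 j hj) K 1
      (by simpa using hsmul)
  · have : Nontrivial K := by
      rw [Submodule.Quotient.nontrivial_iff]
      intro h
      refine not_subsingleton B ?_
      rw [← Submodule.subsingleton_iff R, ← subsingleton_iff_bot_eq_top, eq_comm]
      refine Submodule.eq_bot_of_le_smul_of_le_jacobson_bot (IsLocalRing.maximalIdeal R) ⊤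
        Module.Finite.fg_top ?_ (IsLocalRing.maximalIdeal_le_jacobson _)
      conv_lhs => rw [← h]
      exact Submodule.smul_mono_left (Ideal.span_le.mpr hrs)
    obtain ⟨x, hx⟩ := exists_ne (0 : K)
    let i : (R ⧸ IsLocalRing.maximalIdeal R) →ₗ[R] K :=
      Submodule.liftQ _ (LinearMap.toSpanSingleton R K x) (fun r hr ↦ hsmul r hr x)
    have hi : Function.Injective i := by
      rw [injective_iff_map_eq_zero]
      intro a ha
      obtain ⟨a, rfl⟩ := Submodule.mkQ_surjective _ a
      rw [Submodule.mkQ_apply, Submodule.Quotient.mk_eq_zero, IsLocalRing.mem_maximalIdeal,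
        mem_nonunits_iff]
      intro hu
      have : a • x = 0 := ha
      exact hx (hu.smul_eq_zero.mp this)
    obtain ⟨δ, d1, -⟩ := exists_extPre_connecting Y hi
      (LinearMap.exact_map_mkQ_range i) (Submodule.mkQ_surjective _) d
    have : Subsingleton (ExtMod R (K ⧸ LinearMap.range i) Y (d + 1)) := by
      refine subsingleton_extMod_of_pow_smul (IsLocalRing.maximalIdeal R) Y _
        (h0 _ (by omega)) _ 1 fun r hr z ↦ ?_
      obtain ⟨z, rfl⟩ := Submodule.mkQ_surjective _ z
      rw [← map_smul, hsmul r (by simpa using hr), map_zero]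
    have hsur : Function.Surjective (extPre Y i d) :=
      fun y ↦ (d1 y).mp (Subsingleton.elim _ _)
    exact hsur.nontrivial

lemma isWeaklyRegular_pi (ι : Type) (rs : List R) :
    ∀ (T : Type) [AddCommGroup T] [Module R T], RingTheory.Sequence.IsWeaklyRegular T rs →
      RingTheory.Sequence.IsWeaklyRegular (ι → T) rs := by
  induction rs with
  | nil => exact fun T _ _ _ ↦ RingTheory.Sequence.IsWeaklyRegular.nil R _
  | cons r rs ih =>
    intro T _ _ hT
    rw [RingTheory.Sequence.isWeaklyRegular_cons_iff] at hT ⊢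
    refine ⟨fun a b hab ↦ funext fun i ↦ hT.1 (congrFun hab i), ?_⟩
    refine (LinearEquiv.isWeaklyRegular_congr (quotSMulTopEquivOfExact r
      (LinearMap.compLeft (Submodule.mkQ (r • (⊤ : Submodule R T))) ι) ?_ ?_) rs).mpr (ih _ hT.2)
    · exact (Submodule.mkQ_surjective _).comp_left
    · ext v
      simp only [LinearMap.mem_ker, funext_iff, LinearMap.compLeft_apply, Function.comp_apply,
        Submodule.mkQ_apply, Pi.zero_apply, Submodule.Quotient.mk_eq_zero,
        Submodule.mem_smul_pointwise_iff_exists, Submodule.mem_top, true_and, Pi.smul_apply]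
      exact ⟨fun h ↦ ⟨fun i ↦ (h i).choose, fun i ↦ (h i).choose_spec⟩,
        fun ⟨w, hw⟩ i ↦ ⟨w i, hw i⟩⟩

lemma smul_pi_mem_smul_top (ι : Type) [Finite ι] {T : Type} [AddCommGroup T] [Module R T]
    (J : Ideal R) {r : R} (h : ∀ b : T, r • b ∈ J • (⊤ : Submodule R T)) (v : ι → T) :
    r • v ∈ J • (⊤ : Submodule R (ι → T)) := by
  classical
  have := Fintype.ofFinite ι
  rw [← Finset.univ_sum_single v, Finset.smul_sum]
  refine Submodule.sum_mem _ fun i _ ↦ ?_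
  have h2 : (J • (⊤ : Submodule R T)).map (LinearMap.single R (fun _ ↦ T) i) ≤
      J • (⊤ : Submodule R (ι → T)) := by
    rw [Submodule.map_smul'']
    exact Submodule.smul_mono le_rfl le_top
  have h3 := h2 (Submodule.mem_map_of_mem (h (v i)))
  rwa [map_smul] at h3

end RegularExt

section Chain
open scoped Pointwise
variable {R : Type} [CommRing R]

/-- A module `N` exhausted by an increasing chain of submodules (the images of the `ι t`) starting
at zero, with successive quotients `Q t`. -/
structure IsExhausted {E Q : ℕ → Type} {N : Type} [∀ t, AddCommGroup (E t)] [∀ t, Module R (E t)]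
    [∀ t, AddCommGroup (Q t)] [∀ t, Module R (Q t)] [AddCommGroup N] [Module R N]
    (f : ∀ t, E t →ₗ[R] E (t + 1)) (g : ∀ t, E (t + 1) →ₗ[R] Q t) (ι : ∀ t, E t →ₗ[R] N) :
    Prop where
  injective_f t : Function.Injective (f t)
  exact t : Function.Exact (f t) (g t)
  surjective_g t : Function.Surjective (g t)
  subsingleton_zero : Subsingleton (E 0)
  injective_ι t : Function.Injective (ι t)
  ι_f t e : ι (t + 1) (f t e) = ι t e
  exists_rep x : ∃ t e, ι t e = x

namespace IsExhausted
variable {E Q : ℕ → Type} {N : Type} [∀ t, AddCommGroup (E t)] [∀ t, Module R (E t)]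
    [∀ t, AddCommGroup (Q t)] [∀ t, Module R (Q t)] [AddCommGroup N] [Module R N]
    {f : ∀ t, E t →ₗ[R] E (t + 1)} {g : ∀ t, E (t + 1) →ₗ[R] Q t} {ι : ∀ t, E t →ₗ[R] N}

lemma exists_lift (h : IsExhausted f g ι) {s t : ℕ} (hst : s ≤ t) (e : E s) :
    ∃ e', ι t e' = ι s e := by
  induction t, hst using Nat.le_induction with
  | base => exact ⟨e, rfl⟩
  | succ t _ ih =>
    obtain ⟨e', he'⟩ := ih
    exact ⟨f t e', by rw [h.ι_f, he']⟩

lemma not_finite (h : IsExhausted f g ι) (hQ : ∀ t, Nontrivial (Q t)) : ¬ Module.Finite R N := by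
  rintro ⟨s, hs⟩
  choose T e he using h.exists_rep
  have hsur : Function.Surjective (ι (s.sup T)) := by
    rw [← LinearMap.range_eq_top, eq_top_iff, ← hs, Submodule.span_le]
    intro x hx
    obtain ⟨e', he'⟩ := h.exists_lift (Finset.le_sup (f := T) hx) (e x)
    exact ⟨e', he'.trans (he x)⟩
  have := hQ (s.sup T)
  obtain ⟨q, hq⟩ := exists_ne (0 : Q (s.sup T))
  obtain ⟨y, rfl⟩ := h.surjective_g _ q
  obtain ⟨z, hz⟩ := hsur (ι _ y)
  rw [← h.ι_f] at hz
  exact hq ((h.exact _ y).mpr ⟨z, h.injective_ι _ hz⟩)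

lemma isSMulRegular_chain (h : IsExhausted f g ι) {r : R} (hr : ∀ t, IsSMulRegular (Q t) r)
    (t : ℕ) : IsSMulRegular (E t) r := by
  induction t with
  | zero =>
    have := h.subsingleton_zero
    exact fun a b _ ↦ Subsingleton.elim _ _
  | succ t ih =>
    refine isSMulRegular_of_range_eq_ker (g := g t) (h.injective_f t) ?_ ih (hr t)
    exact (h.exact t).linearMap_ker_eq.symm

lemma isSMulRegular (h : IsExhausted f g ι) {r : R} (hr : ∀ t, IsSMulRegular (Q t) r) :
    IsSMulRegular N r := by
  refine (isSMulRegular_iff_right_eq_zero_of_smul).mpr fun x hx ↦ ?_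
  obtain ⟨t, e, rfl⟩ := h.exists_rep x
  rw [← map_smul, map_eq_zero_iff _ (h.injective_ι t)] at hx
  rw [(isSMulRegular_iff_right_eq_zero_of_smul.mp (h.isSMulRegular_chain hr t)) e hx, map_zero]

lemma quotSMulTop (h : IsExhausted f g ι) {r : R} (hr : ∀ t, IsSMulRegular (Q t) r) :
    IsExhausted (fun t ↦ QuotSMulTop.map r (f t)) (fun t ↦ QuotSMulTop.map r (g t))
      (fun t ↦ QuotSMulTop.map r (ι t)) := by
  have mem {M : Type} [AddCommGroup M] [Module R M] (x : M) :
      (Submodule.Quotient.mk x : QuotSMulTop r M) = 0 ↔ ∃ y, r • y = x := by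
    rw [Submodule.Quotient.mk_eq_zero]
    simp [Submodule.mem_smul_pointwise_iff_exists]
  have hcancel (t) (e : E (t + 1)) (x : E t) (hx : f t x = r • e) : ∃ y, f t y = e :=
    (h.exact t e).mp ((isSMulRegular_iff_right_eq_zero_of_smul.mp (hr t)) _
      (by rw [← map_smul, ← hx]; exact (h.exact t).apply_apply_eq_zero x))
  have hinj (t k) : ∀ (e : E t) (e' : E (t + k)), ι t e = r • ι _ e' → ∃ y, r • y = e := by
    induction k with
    | zero => exact fun e e' hee ↦ ⟨e', h.injective_ι t (by rw [map_smul]; exact hee.symm)⟩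
    | succ k ih =>
      intro e e' hee
      obtain ⟨e₁, he₁⟩ := h.exists_lift (Nat.le_add_right t k) e
      obtain ⟨e₂, rfl⟩ := hcancel (t + k) e' e₁ (h.injective_ι (t + k + 1) (by
        rw [h.ι_f, he₁, map_smul]; exact hee))
      exact ih e e₂ (by rw [hee]; congr 1; exact h.ι_f _ _)
  refine ⟨fun t ↦ ?_, fun t ↦ ?_, fun t ↦ ?_, ?_, fun t ↦ ?_, fun t x ↦ ?_, fun x ↦ ?_⟩
  · rw [injective_iff_map_eq_zero]
    intro x
    obtain ⟨x, rfl⟩ := Submodule.Quotient.mk_surjective _ x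
    rw [QuotSMulTop.map_apply_mk, mem, mem]
    rintro ⟨y, hy⟩
    obtain ⟨z, rfl⟩ := hcancel t y x hy.symm
    exact ⟨z, h.injective_f t (by rw [map_smul, hy])⟩
  · intro x
    obtain ⟨x, rfl⟩ := Submodule.Quotient.mk_surjective _ x
    rw [QuotSMulTop.map_apply_mk, mem]
    constructor
    · rintro ⟨y, hy⟩
      obtain ⟨y, rfl⟩ := h.surjective_g t y
      obtain ⟨z, hz⟩ := (h.exact t (x - r • y)).mp (by rw [map_sub, map_smul, hy, sub_self])
      refine ⟨Submodule.Quotient.mk z, ?_⟩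
      rw [QuotSMulTop.map_apply_mk, hz, Submodule.Quotient.mk_sub, sub_eq_self, mem]
      exact ⟨y, rfl⟩
    · rintro ⟨y, hy⟩
      obtain ⟨y, rfl⟩ := Submodule.Quotient.mk_surjective _ y
      rw [QuotSMulTop.map_apply_mk, ← sub_eq_zero, ← Submodule.Quotient.mk_sub, mem] at hy
      obtain ⟨z, hz⟩ := hy
      refine ⟨- g t z, ?_⟩
      rw [smul_neg, ← map_smul, hz, map_sub, (h.exact t).apply_apply_eq_zero, zero_sub, neg_neg]
  · intro x
    obtain ⟨x, rfl⟩ := Submodule.Quotient.mk_surjective _ x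
    obtain ⟨y, rfl⟩ := h.surjective_g t x
    exact ⟨Submodule.Quotient.mk y, rfl⟩
  · have := h.subsingleton_zero
    exact (Submodule.mkQ_surjective _).subsingleton
  · rw [injective_iff_map_eq_zero]
    intro x
    obtain ⟨x, rfl⟩ := Submodule.Quotient.mk_surjective _ x
    rw [QuotSMulTop.map_apply_mk, mem, mem]
    rintro ⟨y, hy⟩
    obtain ⟨s, e, rfl⟩ := h.exists_rep y
    obtain ⟨e', he'⟩ := h.exists_lift (Nat.le_add_left s t) e
    exact hinj t s x e' (by rw [he', hy])
  · obtain ⟨x, rfl⟩ := Submodule.Quotient.mk_surjective _ x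
    simp only [QuotSMulTop.map_apply_mk, h.ι_f]
  · obtain ⟨x, rfl⟩ := Submodule.Quotient.mk_surjective _ x
    obtain ⟨t, e, rfl⟩ := h.exists_rep x
    exact ⟨t, Submodule.Quotient.mk e, rfl⟩

end IsExhausted

lemma IsExhausted.isWeaklyRegular_and_not_finite (rs : List R) :
    ∀ {E Q : ℕ → Type} {N : Type} [∀ t, AddCommGroup (E t)] [∀ t, Module R (E t)]
    [∀ t, AddCommGroup (Q t)] [∀ t, Module R (Q t)] [AddCommGroup N] [Module R N]
    {f : ∀ t, E t →ₗ[R] E (t + 1)} {g : ∀ t, E (t + 1) →ₗ[R] Q t} {ι : ∀ t, E t →ₗ[R] N},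
    IsExhausted f g ι → (∀ t, RingTheory.Sequence.IsRegular (Q t) rs) →
    RingTheory.Sequence.IsWeaklyRegular N rs ∧
      ¬ Module.Finite R (N ⧸ (Ideal.ofList rs • (⊤ : Submodule R N))) := by
  induction rs with
  | nil =>
    intro E Q N _ _ _ _ _ _ f g ι h hQ
    refine ⟨RingTheory.Sequence.IsWeaklyRegular.nil R N, fun hfin ↦ ?_⟩
    refine h.not_finite (fun t ↦ (hQ t).nontrivial) ?_
    exact Module.Finite.equiv (Submodule.quotEquivOfEqBot _
      ((congrArg (· • ⊤) Ideal.ofList_nil).trans (Submodule.bot_smul _)) :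
      (N ⧸ (Ideal.ofList [] • (⊤ : Submodule R N))) ≃ₗ[R] N)
  | cons r rs ih =>
    intro E Q N _ _ _ _ _ _ f g ι h hQ
    simp only [RingTheory.Sequence.isRegular_cons_iff] at hQ
    obtain ⟨h₁, h₂⟩ := ih (h.quotSMulTop fun t ↦ (hQ t).1) fun t ↦ (hQ t).2
    refine ⟨(RingTheory.Sequence.isWeaklyRegular_cons_iff N r rs).mpr
      ⟨h.isSMulRegular fun t ↦ (hQ t).1, h₁⟩, fun hfin ↦ h₂ ?_⟩
    exact Module.Finite.equiv
      (Submodule.quotOfListConsSMulTopEquivQuotSMulTopInner N r rs)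

end Chain

section Socle
open scoped Pointwise
variable {R : Type} [CommRing R]

lemma subsingleton_and_not_finite_ext (𝔪 : Ideal R) (rs : List R) (hrs : ∀ r ∈ rs, r ∈ 𝔪) :
    ∀ (N : Type) [AddCommGroup N] [Module R N], RingTheory.Sequence.IsWeaklyRegular N rs →
      (∀ r ∈ 𝔪, ∀ x : N, r • x ∈ Ideal.ofList rs • (⊤ : Submodule R N)) →
      ¬ Module.Finite R (N ⧸ (Ideal.ofList rs • (⊤ : Submodule R N))) →
      (∀ j < rs.length, Subsingleton (ExtMod R (R ⧸ 𝔪) N j)) ∧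
        ¬ Module.Finite R (ExtMod R (R ⧸ 𝔪) N rs.length) := by
  induction rs with
  | nil =>
    intro N _ _ _ hN hfin
    refine ⟨by simp, fun h ↦ hfin ?_⟩
    have e0 : Ideal.ofList [] • (⊤ : Submodule R N) = ⊥ :=
      (congrArg (· • ⊤) Ideal.ofList_nil).trans (Submodule.bot_smul _)
    rw [e0] at hN
    have h' : Module.Finite R (ExtMod R (R ⧸ 𝔪) N 0) := h
    have := Module.Finite.equiv (extZeroEquiv (R := R) (R ⧸ 𝔪) N)
    have hsur : Function.Surjective (LinearMap.applyₗ (R := R) (M := R ⧸ 𝔪) (M₂ := N)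
        (Submodule.Quotient.mk 1)) := fun x ↦
      ⟨Submodule.liftQ _ (LinearMap.toSpanSingleton R N x) (fun r hr ↦ by
        simpa using hN r hr x), one_smul R x⟩
    have := Module.Finite.of_surjective _ hsur
    infer_instance
  | cons r rs ih =>
    intro N _ _ hreg hN hfin
    rw [RingTheory.Sequence.isWeaklyRegular_cons_iff] at hreg
    let q := Submodule.quotOfListConsSMulTopEquivQuotSMulTopInner N r rs
    obtain ⟨i0, i1⟩ := ih (fun r h ↦ hrs r (List.mem_cons_of_mem _ h)) (QuotSMulTop r N) hreg.2
      (fun s hs x ↦ by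
        obtain ⟨x, rfl⟩ := Submodule.mkQ_surjective _ x
        have h1 := hN s hs x
        rw [Ideal.ofList_cons_smul] at h1
        obtain ⟨a, ha, b, hb, hab⟩ := Submodule.mem_sup.mp h1
        rw [← map_smul, ← hab, map_add]
        have ha' : (Submodule.mkQ (r • (⊤ : Submodule R N))) a = 0 := by
          rwa [Submodule.mkQ_apply, Submodule.Quotient.mk_eq_zero]
        rw [ha', zero_add]
        have := Submodule.mem_map_of_mem (f := Submodule.mkQ (r • (⊤ : Submodule R N))) hb
        rw [Submodule.map_smul''] at this
        exact Submodule.smul_mono le_rfl le_top this)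
      (fun h ↦ hfin (Module.Finite.equiv q.symm))
    have hr := hrs r List.mem_cons_self
    have ex := exact_smul_quotSMulTop r N
    have inj : Function.Injective (r • (LinearMap.id : N →ₗ[R] N)) := fun a b h ↦ hreg.1 h
    have sur := Submodule.mkQ_surjective (r • (⊤ : Submodule R N))
    have ev (j) (x : ExtMod R (R ⧸ 𝔪) N j) :
        extPost (R ⧸ 𝔪) (r • (LinearMap.id : N →ₗ[R] N)) j x = 0 := by
      rw [extPost_smul_id]
      refine smul_extMod_eq_zero (fun y ↦ ?_) _ _
      obtain ⟨y, rfl⟩ := Submodule.mkQ_surjective _ y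
      rw [← map_smul, Submodule.mkQ_apply, Submodule.Quotient.mk_eq_zero]
      exact Ideal.mul_mem_right _ _ hr
    have van : ∀ j < rs.length + 1, Subsingleton (ExtMod R (R ⧸ 𝔪) N j) := by
      intro j hj
      refine subsingleton_of_forall_eq 0 fun x ↦ ?_
      cases j with
      | zero =>
        refine extPost_injective_zero (R ⧸ 𝔪) inj ?_
        rw [ev, map_zero]
      | succ j =>
        obtain ⟨δ, -, d2⟩ := exists_extPost_connecting (R ⧸ 𝔪) inj ex sur j
        obtain ⟨y, rfl⟩ := (d2 x).mp (ev _ _)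
        have : Subsingleton (ExtMod R (R ⧸ 𝔪) (N ⧸ (r • (⊤ : Submodule R N))) j) :=
          i0 j (by omega)
        rw [Subsingleton.elim y 0, map_zero]
    refine ⟨van, fun h ↦ i1 ?_⟩
    obtain ⟨δ, d1, d2⟩ := exists_extPost_connecting (R ⧸ 𝔪) inj ex sur rs.length
    have h' : Module.Finite R (ExtMod R (R ⧸ 𝔪) N (rs.length + 1)) := h
    refine Module.Finite.equiv (LinearEquiv.ofBijective δ ⟨?_, fun y ↦ (d2 y).mp (ev _ _)⟩).symm
    rw [injective_iff_map_eq_zero]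
    intro a ha
    obtain ⟨b, rfl⟩ := (d1 a).mp ha
    have := van rs.length (by omega)
    rw [Subsingleton.elim b 0, map_zero]

lemma localCohomologyι_one_injective [IsNoetherianRing R] (𝔪 : Ideal R) [𝔪.IsMaximal]
    (N : ModuleCat.{0} R) (m : ℕ) (h : ∀ j < m, Subsingleton (ExtMod R (R ⧸ 𝔪) N j)) :
    Function.Injective (localCohomologyι 𝔪 m N 1) := by
  rw [injective_iff_map_eq_zero]
  intro e he
  obtain ⟨t, ht, h0⟩ := localCohomologyι_eq_zero 𝔪 m N e he
  let p : (R ⧸ 𝔪 ^ t) →ₗ[R] (R ⧸ 𝔪 ^ 1) := (powQuotMap 𝔪 ht).hom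
  have hp : Function.Surjective p := by
    intro x
    obtain ⟨x, rfl⟩ := Submodule.mkQ_surjective _ x
    exact ⟨Submodule.mkQ _ x, rfl⟩
  have h0' : extPre N p m e = 0 := h0
  refine (injective_iff_map_eq_zero (extPre N p m)).mp ?_ e h0'
  cases m with
  | zero => exact extPre_injective_zero N hp
  | succ m =>
    have ex : Function.Exact (LinearMap.ker p).subtype p := by intro x; simp
    obtain ⟨δ, -, d2⟩ := exists_extPre_connecting N (Submodule.subtype_injective _) ex hp m
    rw [injective_iff_map_eq_zero]
    intro a ha
    obtain ⟨b, rfl⟩ := (d2 a).mp ha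
    have : Subsingleton (ExtMod R (LinearMap.ker p) N m) := by
      refine subsingleton_extMod_of_pow_smul 𝔪 N m (h m (by omega)) _ t fun r hr c ↦ ?_
      refine Subtype.ext ?_
      obtain ⟨x, hx⟩ := Submodule.mkQ_surjective _ (c : R ⧸ 𝔪 ^ t)
      rw [Submodule.coe_smul, ← hx, ← map_smul, Submodule.mkQ_apply, Submodule.coe_zero,
        Submodule.Quotient.mk_eq_zero]
      exact Ideal.mul_mem_right _ _ hr
    rw [Subsingleton.elim b 0, map_zero]

lemma not_finite_socle_localCohomology [IsNoetherianRing R] (𝔪 : Ideal R) [𝔪.IsMaximal]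
    (N : ModuleCat.{0} R) (m : ℕ) (h : ∀ j < m, Subsingleton (ExtMod R (R ⧸ 𝔪) N j))
    (hm : ¬ Module.Finite R (ExtMod R (R ⧸ 𝔪) N m)) :
    ¬ Module.Finite R ((R ⧸ 𝔪) →ₗ[R] (localCohomology 𝔪 m).obj N) := by
  intro hfin
  apply hm
  let H := (localCohomology 𝔪 m).obj N
  let ev : ((R ⧸ 𝔪) →ₗ[R] H) →ₗ[R] H :=
    LinearMap.applyₗ (R := R) (M := R ⧸ 𝔪) (M₂ := H) (Submodule.Quotient.mk 1)
  let ι := localCohomologyι 𝔪 m N 1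
  have hι : ∀ e, ι e ∈ LinearMap.range ev := by
    intro e
    refine ⟨Submodule.liftQ _ (LinearMap.toSpanSingleton R H (ι e)) (fun r hr ↦ ?_),
      one_smul R _⟩
    rw [LinearMap.mem_ker, LinearMap.toSpanSingleton_apply, ← map_smul]
    have : r • e = 0 := by
      refine smul_extMod_eq_zero (M := R ⧸ 𝔪 ^ 1) (Y := N) (fun y ↦ ?_) m e
      obtain ⟨y, rfl⟩ := Submodule.mkQ_surjective _ y
      rw [← map_smul, Submodule.mkQ_apply, Submodule.Quotient.mk_eq_zero]
      exact Ideal.mul_mem_right _ _ (by simpa using hr)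
    rw [this, map_zero]
  have hinj : Function.Injective (LinearMap.codRestrict (LinearMap.range ev) ι hι) := by
    intro a b hab
    exact localCohomologyι_one_injective 𝔪 N m h (congrArg Subtype.val hab)
  have h1 : Module.Finite R (ExtMod R (R ⧸ 𝔪 ^ 1) N m) := Module.Finite.of_injective _ hinj
  exact Module.Finite.equiv (extPreEquiv N (Submodule.quotEquivOfEq _ _ (pow_one 𝔪).symm) m)

end Socle

section Tower
variable {R : Type} [CommRing R]

/-- A tower of `R`-modules `⋯ → C 2 → C 1 → C 0 = 0` of surjections whose kernels `B t` have
`xs` as weakly regular sequence with `𝔪 B = (xs) B`, together with maps `R/I^t → C t` which are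
isomorphisms up to `𝔪`-power torsion, and such that multiplication by elements of `𝔪` on `C t`
factors through multiplication by elements of `xs`. -/
structure IsApproximatingTower (𝔪 I : Ideal R) (xs : List R) {C B : ℕ → Type}
    [∀ t, AddCommGroup (C t)] [∀ t, Module R (C t)]
    [∀ t, AddCommGroup (B t)] [∀ t, Module R (B t)]
    (i : ∀ t, B t →ₗ[R] C (t + 1)) (c : ∀ t, C (t + 1) →ₗ[R] C t)
    (h : ∀ t, (R ⧸ I ^ t) →ₗ[R] C t) : Prop where
  injective_i t : Function.Injective (i t)
  exact t : Function.Exact (i t) (c t)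
  surjective_c t : Function.Surjective (c t)
  subsingleton_zero : Subsingleton (C 0)
  finite_B t : Module.Finite R (B t)
  nontrivial_B t : Nontrivial (B t)
  regular_B t : RingTheory.Sequence.IsWeaklyRegular (B t) xs
  smul_mem_B t : ∀ r ∈ 𝔪, ∀ b : B t, r • b ∈ Ideal.ofList xs • (⊤ : Submodule R (B t))
  c_h t : c t ∘ₗ h (t + 1) = h t ∘ₗ (powQuotMap I t.le_succ).hom
  ker_h t : ∃ N, ∀ r ∈ 𝔪 ^ N, ∀ x, h t x = 0 → r • x = 0
  coker_h t : ∃ N, ∀ r ∈ 𝔪 ^ N, ∀ x, ∃ y, h t y = r • x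
  smul_C : ∃ G : Set R, 𝔪 = Ideal.span G ∧ ∀ r ∈ G, ∃ x ∈ xs, ∀ t, ∃ s : C t →ₗ[R] C t,
    ∀ z, r • z = x • s z

namespace IsApproximatingTower
variable {𝔪 I : Ideal R} {xs : List R} {C B : ℕ → Type}
    [∀ t, AddCommGroup (C t)] [∀ t, Module R (C t)]
    [∀ t, AddCommGroup (B t)] [∀ t, Module R (B t)]
    {i : ∀ t, B t →ₗ[R] C (t + 1)} {c : ∀ t, C (t + 1) →ₗ[R] C t}
    {h : ∀ t, (R ⧸ I ^ t) →ₗ[R] C t}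

lemma finite_C (H : IsApproximatingTower 𝔪 I xs i c h) (t : ℕ) : Module.Finite R (C t) := by
  induction t with
  | zero =>
    have := H.subsingleton_zero
    infer_instance
  | succ t ih =>
    have := H.finite_B t
    constructor
    refine Submodule.fg_of_fg_map_of_fg_inf_ker (c t) ?_ ?_
    · rw [Submodule.map_top, LinearMap.range_eq_top.mpr (H.surjective_c t)]
      exact ih.1
    · rw [top_inf_eq, (H.exact t).linearMap_ker_eq, LinearMap.range_eq_map]
      exact Submodule.FG.map _ Module.Finite.fg_top

variable {Y : ModuleCat.{0} R} {q : ℕ}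

lemma subsingleton_extMod_C (H : IsApproximatingTower 𝔪 I xs i c h)
    (hB : ∀ t, ∀ j ≠ q, Subsingleton (ExtMod R (B t) Y j)) (t : ℕ) :
    ∀ j ≠ q, Subsingleton (ExtMod R (C t) Y j) := by
  induction t with
  | zero =>
    have := H.subsingleton_zero
    exact fun j _ ↦ subsingleton_extMod_of_subsingleton j
  | succ t ih =>
    intro j hj
    have := hB t j hj
    have := ih j hj
    exact subsingleton_of_exact
      (extPre_exact Y (H.injective_i t) (H.exact t) (H.surjective_c t) j)

lemma powQuotMap_hom_comp (I : Ideal R) {s t u : ℕ} (hst : s ≤ t) (htu : t ≤ u) :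
    (powQuotMap I hst).hom ∘ₗ (powQuotMap I htu).hom = (powQuotMap I (hst.trans htu)).hom := by
  refine LinearMap.ext fun x ↦ ?_
  obtain ⟨x, rfl⟩ := Submodule.mkQ_surjective _ x
  rfl

lemma isExhausted [IsNoetherianRing R] [𝔪.IsMaximal] (H : IsApproximatingTower 𝔪 I xs i c h)
    (hB : ∀ t, ∀ j ≠ q, Subsingleton (ExtMod R (B t) Y j))
    (h0 : ∀ j ≤ q + 1, Subsingleton (ExtMod R (R ⧸ 𝔪) Y j)) :
    IsExhausted (fun t ↦ extPre Y (c t) q) (fun t ↦ extPre Y (i t) q)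
      (fun t ↦ localCohomologyι I q Y t ∘ₗ extPre Y (h t) q) := by
  have hbij (t) : Function.Bijective (extPre Y (h t) q) := by
    have := H.finite_C t
    obtain ⟨N₁, h₁⟩ := H.ker_h t
    obtain ⟨N₂, h₂⟩ := H.coker_h t
    refine bijective_extPre_of_pow_smul 𝔪 Y q h0 (h t) inferInstance (max N₁ N₂)
      (fun r hr x hx ↦ h₁ r (Ideal.pow_le_pow_right (le_max_left _ _) hr) x hx)
      (fun r hr x ↦ h₂ r (Ideal.pow_le_pow_right (le_max_right _ _) hr) x)
  have hf (t) : Function.Injective (extPre Y (c t) q) := by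
    cases q with
    | zero => exact extPre_injective_zero Y (H.surjective_c t)
    | succ q =>
      obtain ⟨δ, -, d2⟩ :=
        exists_extPre_connecting Y (H.injective_i t) (H.exact t) (H.surjective_c t) q
      rw [injective_iff_map_eq_zero]
      intro a ha
      obtain ⟨b, rfl⟩ := (d2 a).mp ha
      have := hB t q (by omega)
      rw [Subsingleton.elim b 0, map_zero]
  have hch (t) (e : ExtMod R (C t) Y q) : extPre Y (h (t + 1)) q (extPre Y (c t) q e) =
      extPre Y (powQuotMap I t.le_succ).hom q (extPre Y (h t) q e) := by
    rw [← extPre_comp, H.c_h, extPre_comp]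
  refine ⟨hf, fun t ↦ extPre_exact Y (H.injective_i t) (H.exact t) (H.surjective_c t) q,
    fun t ↦ ?_, ?_, fun t ↦ ?_, fun t e ↦ ?_, fun x ↦ ?_⟩
  · obtain ⟨δ, d1, -⟩ :=
        exists_extPre_connecting Y (H.injective_i t) (H.exact t) (H.surjective_c t) q
    intro y
    have := H.subsingleton_extMod_C hB t (q + 1) (by omega)
    exact (d1 y).mp (Subsingleton.elim _ _)
  · have := H.subsingleton_zero
    exact subsingleton_extMod_of_subsingleton q
  · rw [injective_iff_map_eq_zero]
    intro e he
    obtain ⟨u, htu, hu⟩ := localCohomologyι_eq_zero I q Y _ he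
    have key : ∃ e', extPre Y (h u) q e' =
        extPre Y (powQuotMap I htu).hom q (extPre Y (h t) q e) ∧ (e' = 0 → e = 0) := by
      clear hu
      induction u, htu using Nat.le_induction with
      | base =>
        refine ⟨e, ?_, id⟩
        have : (powQuotMap I (le_refl t)).hom = LinearMap.id := by
          refine LinearMap.ext fun x ↦ ?_
          obtain ⟨x, rfl⟩ := Submodule.mkQ_surjective _ x
          rfl
        rw [this, extPre_id]
      | succ u hu ih =>
        obtain ⟨e', he', h'⟩ := ih
        refine ⟨extPre Y (c u) q e', ?_,
          fun h0 ↦ h' ((injective_iff_map_eq_zero _).mp (hf u) _ h0)⟩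
        rw [hch, he', ← extPre_comp, powQuotMap_hom_comp]
    obtain ⟨e', he', h'⟩ := key
    exact h' ((injective_iff_map_eq_zero _).mp (hbij u).1 _ (he'.trans hu))
  · rw [LinearMap.comp_apply, hch]
    exact localCohomologyι_powQuotMap I q Y t.le_succ _
  · obtain ⟨t, e, rfl⟩ := localCohomologyι_exists_rep I q Y x
    obtain ⟨e, rfl⟩ := (hbij t).2 e
    exact ⟨t, e, rfl⟩

lemma smul_mem [IsNoetherianRing R] [𝔪.IsMaximal] (H : IsApproximatingTower 𝔪 I xs i c h)
    (hB : ∀ t, ∀ j ≠ q, Subsingleton (ExtMod R (B t) Y j))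
    (h0 : ∀ j ≤ q + 1, Subsingleton (ExtMod R (R ⧸ 𝔪) Y j)) :
    ∀ r ∈ 𝔪, ∀ x : (localCohomology I q).obj Y,
      r • x ∈ Ideal.ofList xs • (⊤ : Submodule R ((localCohomology I q).obj Y)) := by
  obtain ⟨G, rfl, hG⟩ := H.smul_C
  intro r hr
  induction hr using Submodule.span_induction with
  | mem r hr =>
    intro z
    obtain ⟨x, hx, hs⟩ := hG r hr
    obtain ⟨t, e, rfl⟩ := (H.isExhausted hB h0).exists_rep z
    obtain ⟨s, hs⟩ := hs t
    have he : r • e = x • extPre Y s q e := by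
      rw [← extPre_smul, ← extPre_id Y q e, ← extPre_smul, extPre_id]
      congr 1
      congr 1
      exact LinearMap.ext hs
    rw [← map_smul, he, map_smul]
    exact Submodule.smul_mem_smul (Ideal.subset_span hx) trivial
  | zero => intro x; simp
  | add a b _ _ ha hb => intro x; rw [add_smul]; exact add_mem (ha x) (hb x)
  | smul a b _ hb => intro x; rw [smul_eq_mul, mul_smul]; exact Submodule.smul_mem _ _ (hb x)

theorem not_finite_socle [IsNoetherianRing R] [IsLocalRing R] [Module.Finite R Y]
    (h𝔪 : 𝔪 = IsLocalRing.maximalIdeal R)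
    (H : IsApproximatingTower 𝔪 I xs i c h) (hxs : ∀ r ∈ xs, r ∈ 𝔪) (hlen : 2 ≤ xs.length)
    (h0 : ∀ j ≠ q + xs.length, Subsingleton (ExtMod R (R ⧸ 𝔪) Y j))
    (h1 : Nontrivial (ExtMod R (R ⧸ 𝔪) Y (q + xs.length))) :
    ¬ Module.Finite R ((R ⧸ 𝔪) →ₗ[R]
      (localCohomology 𝔪 xs.length).obj ((localCohomology I q).obj Y)) := by
  subst h𝔪
  have hB (t) := have := H.finite_B t; have := H.nontrivial_B t
    isRegular_extMod Y (q + xs.length) h0 h1 xs hxs (B t) (H.regular_B t) (H.smul_mem_B t) q rfl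
  have hB0 := fun t ↦ (hB t).1
  have h0' : ∀ j ≤ q + 1, Subsingleton (ExtMod R (R ⧸ IsLocalRing.maximalIdeal R) Y j) :=
    fun j hj ↦ h0 j (by omega)
  have ex := H.isExhausted hB0 h0'
  obtain ⟨w, nf⟩ := ex.isWeaklyRegular_and_not_finite xs fun t ↦ (hB t).2
  obtain ⟨van, nf'⟩ := subsingleton_and_not_finite_ext (IsLocalRing.maximalIdeal R) xs hxs _ w
    (H.smul_mem hB0 h0') nf
  exact not_finite_socle_localCohomology _ _ _ van nf'

end IsApproximatingTower
end Tower

section DegreeFiltration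
variable {τ T S : Type} [CommRing T] [CommRing S]

/-- The product of a power series with one of order at least `t` has, in degrees at most `t`,
the coefficients of the latter multiplied by the constant coefficient of the former. -/
lemma coeff_mul_of_forall_degree_lt (g f : MvPowerSeries τ T) {t : ℕ}
    (hf : ∀ β : τ →₀ ℕ, β.degree < t → coeff β f = 0) {β : τ →₀ ℕ} (hβ : β.degree ≤ t) :
    coeff β (g * f) = constantCoeff g * coeff β f := by
  classical
  rw [coeff_mul, Finset.sum_eq_single (0, β)]
  · simp
  · rintro ⟨γ, δ⟩ h hne
    rw [Finset.HasAntidiagonal.mem_antidiagonal] at h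
    simp only at h
    subst h
    rw [map_add] at hβ
    have : γ.degree ≠ 0 := by
      intro h0
      rw [Finsupp.degree_eq_zero_iff] at h0
      simp [h0] at hne
    rw [hf δ (by omega), mul_zero]
  · simp

/-- The ideal corresponding, under a ring isomorphism with a power series ring, to the power
series of order at least `t`. -/
def degreeIdeal (e : S ≃+* MvPowerSeries τ T) (t : ℕ) : Ideal S where
  carrier := {f | ∀ β : τ →₀ ℕ, β.degree < t → coeff β (e f) = 0}
  add_mem' hf hg β hβ := by rw [map_add, map_add, hf β hβ, hg β hβ, add_zero]
  zero_mem' β hβ := by simp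
  smul_mem' g f hf β hβ := by
    rw [smul_eq_mul, map_mul, coeff_mul_of_forall_degree_lt _ _ hf hβ.le, hf β hβ, mul_zero]

lemma degreeIdeal_succ_le (e : S ≃+* MvPowerSeries τ T) (t : ℕ) :
    degreeIdeal e (t + 1) ≤ degreeIdeal e t :=
  fun _ hf β hβ => hf β (by omega)

lemma degreeIdeal_zero (e : S ≃+* MvPowerSeries τ T) : degreeIdeal e 0 = ⊤ := by
  rw [Ideal.eq_top_iff_one]
  intro β hβ
  omega

lemma coeff_mul_of_mem_degreeIdeal {e : S ≃+* MvPowerSeries τ T} {t : ℕ} {f : S}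
    (hf : f ∈ degreeIdeal e t) (g : S) {β : τ →₀ ℕ} (hβ : β.degree ≤ t) :
    coeff β (e (g * f)) = constantCoeff (e g) * coeff β (e f) := by
  rw [map_mul, coeff_mul_of_forall_degree_lt _ _ hf hβ]

lemma mul_mem_degreeIdeal_succ {e : S ≃+* MvPowerSeries τ T} {t : ℕ} {f g : S}
    (hf : f ∈ degreeIdeal e t) (hg : constantCoeff (e g) = 0) : g * f ∈ degreeIdeal e (t + 1) :=
  fun β hβ => by rw [coeff_mul_of_mem_degreeIdeal hf g (by omega), hg, zero_mul]

lemma pow_mem_degreeIdeal {e : S ≃+* MvPowerSeries τ T} {g : S}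
    (hg : constantCoeff (e g) = 0) (t : ℕ) : g ^ t ∈ degreeIdeal e t := by
  induction t with
  | zero => rw [degreeIdeal_zero]; trivial
  | succ t ih => rw [pow_succ']; exact mul_mem_degreeIdeal_succ ih hg

/-- The exponents of total degree `t`. -/
abbrev DegreeEq (τ : Type) (t : ℕ) := {β : τ →₀ ℕ // β.degree = t}

instance [Finite τ] (t : ℕ) : Finite (DegreeEq τ t) := by
  have := Fintype.ofFinite τ
  classical
  refine Set.Finite.subset (Finset.finite_toSet (Finset.univ.finsuppAntidiag t)) ?_
  intro β hβ
  have : β.degree = t := hβ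
  simp [Finset.mem_finsuppAntidiag, ← Finsupp.degree_eq_sum, this]

instance [Nonempty τ] (t : ℕ) : Nonempty (DegreeEq τ t) :=
  ⟨⟨Finsupp.single (Classical.arbitrary τ) t, by simp⟩⟩

/-- The element corresponding to the homogeneous power series with given coefficients. -/
def homogeneousOf (e : S ≃+* MvPowerSeries τ T) (t : ℕ) (v : DegreeEq τ t → T) : S :=
  open scoped Classical in
  e.symm (fun β => if h : β.degree = t then v ⟨β, h⟩ else 0)

lemma coeff_homogeneousOf (e : S ≃+* MvPowerSeries τ T) (t : ℕ) (v : DegreeEq τ t → T)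
    (β : τ →₀ ℕ) [Decidable (β.degree = t)] :
    coeff β (e (homogeneousOf e t v)) = if h : β.degree = t then v ⟨β, h⟩ else 0 := by
  refine (congrArg (coeff β) (e.apply_symm_apply _)).trans ((coeff_apply _ _).trans ?_)
  congr

lemma homogeneousOf_mem (e : S ≃+* MvPowerSeries τ T) (t : ℕ) (v : DegreeEq τ t → T) :
    homogeneousOf e t v ∈ degreeIdeal e t := by
  classical
  intro β hβ
  rw [coeff_homogeneousOf, dif_neg hβ.ne]

lemma mem_degreeIdeal_succ_iff {e : S ≃+* MvPowerSeries τ T} {t : ℕ} {f : S}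
    (hf : f ∈ degreeIdeal e t) :
    f ∈ degreeIdeal e (t + 1) ↔ ∀ β : DegreeEq τ t, coeff β.1 (e f) = 0 := by
  refine ⟨fun h β => h β.1 (by rw [β.2]; omega), fun h β hβ => ?_⟩
  rcases Nat.lt_succ_iff_lt_or_eq.mp hβ with h' | h'
  · exact hf β h'
  · exact h ⟨β, h'⟩

variable {R : Type} [CommRing R] [Algebra R S]

/-- The transition maps of the quotients by the degree filtration. -/
def degreeTransition (R : Type) [CommRing R] [Algebra R S] (e : S ≃+* MvPowerSeries τ T) (t : ℕ) :
    (S ⧸ degreeIdeal e (t + 1)) →ₗ[R] S ⧸ degreeIdeal e t :=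
  (Ideal.Quotient.factorₐ R (degreeIdeal_succ_le e t)).toLinearMap

lemma degreeTransition_mk (e : S ≃+* MvPowerSeries τ T) (t : ℕ) (f : S) :
    degreeTransition R e t (Ideal.Quotient.mk _ f) = Ideal.Quotient.mk _ f := rfl

lemma degreeTransition_surjective (e : S ≃+* MvPowerSeries τ T) (t : ℕ) :
    Function.Surjective (degreeTransition R e t) := by
  intro z
  obtain ⟨f, rfl⟩ := Ideal.Quotient.mk_surjective z
  exact ⟨Ideal.Quotient.mk _ f, rfl⟩

variable [Algebra R T]

/-- The inclusion of the degree `t` component into the power series modulo order `t + 1`. -/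
def homogeneousIncl (e : S ≃+* MvPowerSeries τ T)
    (he : ∀ r : R, constantCoeff (e (algebraMap R S r)) = algebraMap R T r) (t : ℕ) :
    (DegreeEq τ t → T) →ₗ[R] S ⧸ degreeIdeal e (t + 1) where
  toFun v := Ideal.Quotient.mk _ (homogeneousOf e t v)
  map_add' v w := by
    classical
    rw [← map_add, Ideal.Quotient.mk_eq_mk_iff_sub_mem,
      mem_degreeIdeal_succ_iff (sub_mem (homogeneousOf_mem _ _ _)
        (add_mem (homogeneousOf_mem _ _ _) (homogeneousOf_mem _ _ _)))]
    intro β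
    simp [coeff_homogeneousOf, β.2]
  map_smul' r v := by
    classical
    rw [RingHom.id_apply, ← Ideal.Quotient.mkₐ_eq_mk R, ← map_smul, Ideal.Quotient.mkₐ_eq_mk,
      Ideal.Quotient.mk_eq_mk_iff_sub_mem, Algebra.smul_def r (homogeneousOf e t v),
      mem_degreeIdeal_succ_iff (sub_mem (homogeneousOf_mem _ _ _)
        (Ideal.mul_mem_left _ _ (homogeneousOf_mem _ _ _)))]
    intro β
    rw [map_sub, map_sub, coeff_mul_of_mem_degreeIdeal (homogeneousOf_mem _ _ _) _ β.2.le, he]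
    simp [coeff_homogeneousOf, β.2, Algebra.smul_def]

lemma homogeneousIncl_injective (e : S ≃+* MvPowerSeries τ T)
    (he : ∀ r : R, constantCoeff (e (algebraMap R S r)) = algebraMap R T r) (t : ℕ) :
    Function.Injective (homogeneousIncl e he t) := by
  classical
  rw [injective_iff_map_eq_zero]
  intro v hv
  replace hv := (mem_degreeIdeal_succ_iff (homogeneousOf_mem e t v)).mp
    (Ideal.Quotient.eq_zero_iff_mem.mp hv)
  ext β
  simpa [coeff_homogeneousOf, β.2] using hv β

lemma exact_homogeneousIncl_degreeTransition (e : S ≃+* MvPowerSeries τ T)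
    (he : ∀ r : R, constantCoeff (e (algebraMap R S r)) = algebraMap R T r) (t : ℕ) :
    Function.Exact (homogeneousIncl e he t) (degreeTransition R e t) := by
  classical
  intro z
  obtain ⟨f, rfl⟩ := Ideal.Quotient.mk_surjective z
  rw [degreeTransition_mk, Ideal.Quotient.eq_zero_iff_mem]
  constructor
  · intro hf
    refine ⟨fun β => coeff β.1 (e f), ?_⟩
    change Ideal.Quotient.mk _ _ = _
    rw [Ideal.Quotient.mk_eq_mk_iff_sub_mem,
      mem_degreeIdeal_succ_iff (sub_mem (homogeneousOf_mem _ _ _) hf)]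
    intro β
    simp [coeff_homogeneousOf, β.2]
  · rintro ⟨v, hv⟩
    have hv : Ideal.Quotient.mk _ _ = _ := hv
    rw [Ideal.Quotient.mk_eq_mk_iff_sub_mem] at hv
    rw [← sub_sub_cancel (homogeneousOf e t v) f]
    exact sub_mem (homogeneousOf_mem _ _ _) (degreeIdeal_succ_le _ _ hv)

lemma algebraMap_mem_degreeIdeal_of_mem_pow (e : S ≃+* MvPowerSeries τ T)
    (he : ∀ r : R, constantCoeff (e (algebraMap R S r)) = algebraMap R T r) {I : Ideal R}
    (hI : ∀ r ∈ I, algebraMap R T r = 0) (t : ℕ) :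
    ∀ r ∈ I ^ t, algebraMap R S r ∈ degreeIdeal e t := by
  induction t with
  | zero => intro r _; rw [degreeIdeal_zero]; trivial
  | succ t ih =>
    intro r hr
    rw [pow_succ'] at hr
    refine Submodule.mul_induction_on hr (fun a ha b hb => ?_) fun a b ha hb => ?_
    · rw [map_mul]
      exact mul_mem_degreeIdeal_succ (ih b hb) (by rw [he, hI a ha])
    · rw [map_add]
      exact add_mem ha hb

/-- The map from `R / I ^ t` to the power series modulo order `t`. -/
def powQuotToDegreeQuot (e : S ≃+* MvPowerSeries τ T)
    (he : ∀ r : R, constantCoeff (e (algebraMap R S r)) = algebraMap R T r) {I : Ideal R}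
    (hI : ∀ r ∈ I, algebraMap R T r = 0) (t : ℕ) : (R ⧸ I ^ t) →ₗ[R] S ⧸ degreeIdeal e t :=
  Submodule.liftQ (I ^ t) (Algebra.linearMap R (S ⧸ degreeIdeal e t)) fun r hr =>
    Ideal.Quotient.eq_zero_iff_mem.mpr (algebraMap_mem_degreeIdeal_of_mem_pow e he hI t r hr)

lemma powQuotToDegreeQuot_mk (e : S ≃+* MvPowerSeries τ T)
    (he : ∀ r : R, constantCoeff (e (algebraMap R S r)) = algebraMap R T r) {I : Ideal R}
    (hI : ∀ r ∈ I, algebraMap R T r = 0) (t : ℕ) (r : R) :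
    powQuotToDegreeQuot e he hI t (Ideal.Quotient.mk _ r) =
      Ideal.Quotient.mk _ (algebraMap R S r) := rfl

end DegreeFiltration

section Determinantal
variable {R S T σ τ : Type} [CommRing R] [CommRing S] [CommRing T] [Algebra R S] [Algebra R T]

/-- The relations between the two actions of `R` that make the degree filtration of a power
series ring approximate the filtration of `R` by powers of the ideal generated by the `y i j`. -/
structure IsSegreLike (x : σ → R) (y : σ → τ → R) (e : S ≃+* MvPowerSeries τ T) : Prop where
  constantCoeff r : constantCoeff (e (algebraMap R S r)) = algebraMap R T r
  map_x i : e (algebraMap R S (x i)) = C (algebraMap R T (x i))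
  map_y i j : e (algebraMap R S (y i j)) = X j * C (algebraMap R T (x i))
  minor i k j : x i * y k j = x k * y i j
  surjective : Function.Surjective (algebraMap R T)
  ker r : algebraMap R T r = 0 ↔ r ∈ Ideal.span (Set.range fun p : σ × τ => y p.1 p.2)
  nonZeroDivisor i (a : T) : algebraMap R T (x i) * a = 0 → a = 0

namespace IsSegreLike
variable {x : σ → R} {y : σ → τ → R} {e : S ≃+* MvPowerSeries τ T}

lemma map_monomial (H : IsSegreLike x y e) (i : σ) (β : τ →₀ ℕ) :
    e (algebraMap R S (β.prod fun j k => y i j ^ k)) =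
      monomial β (algebraMap R T (x i) ^ β.degree) := by
  classical
  induction β using Finsupp.induction with
  | zero => simp
  | single_add j k f hj hk ih =>
    rw [Finsupp.prod_add_index' (by simp) (fun _ _ _ => pow_add _ _ _), map_mul, map_mul, ih,
      Finsupp.prod_single_index (by simp), map_pow, map_pow, H.map_y, mul_pow, X_pow_eq,
      ← map_pow, mul_assoc, ← monomial_zero_eq_C_apply, monomial_mul_monomial,
      monomial_mul_monomial, zero_add, one_mul, map_add, Finsupp.degree_single, pow_add]

lemma exists_sub_mem (H : IsSegreLike x y e) [Finite τ] (i : σ) {t : ℕ} {f : S}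
    (hf : f ∈ degreeIdeal e t) :
    ∃ r : R, algebraMap R S (x i) ^ t * f - algebraMap R S r ∈ degreeIdeal e (t + 1) := by
  classical
  have := Fintype.ofFinite (DegreeEq τ t)
  choose r hr using fun β : DegreeEq τ t => H.surjective (coeff β.1 (e f))
  refine ⟨∑ β : DegreeEq τ t, r β * β.1.prod fun j k => y i j ^ k, ?_⟩
  have hmem (β : DegreeEq τ t) :
      algebraMap R S (β.1.prod fun j k => y i j ^ k) ∈ degreeIdeal e t := by
    intro γ hγ
    rw [H.map_monomial, coeff_monomial_ne]
    rintro rfl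
    exact hγ.ne β.2
  have hmem' (β : DegreeEq τ t) :
      algebraMap R S (r β * β.1.prod fun j k => y i j ^ k) ∈ degreeIdeal e t := by
    rw [map_mul]
    exact Ideal.mul_mem_left _ _ (hmem β)
  rw [mem_degreeIdeal_succ_iff (sub_mem (Ideal.mul_mem_left _ _ hf)
    (by rw [map_sum]; exact sum_mem fun β _ => hmem' β))]
  intro γ
  rw [map_sub, map_sub, coeff_mul_of_mem_degreeIdeal hf _ γ.2.le, map_sum, map_sum, map_sum,
    Finset.sum_eq_single γ]
  · rw [map_mul, coeff_mul_of_mem_degreeIdeal (hmem γ) _ γ.2.le, H.constantCoeff, hr,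
      H.map_monomial, coeff_monomial_same, ← map_pow, H.constantCoeff, map_pow, γ.2, mul_comm,
      sub_self]
  · intro β _ hβ
    rw [map_mul, coeff_mul_of_mem_degreeIdeal (hmem β) _ γ.2.le, H.map_monomial,
      coeff_monomial_ne (fun h => hβ (Subtype.ext h.symm)), mul_zero]
  · simp

lemma exists_pow_mul_sub_mem (H : IsSegreLike x y e) [Finite τ] (i : σ) (t : ℕ) :
    ∃ N, ∀ f : S, ∃ r : R, algebraMap R S (x i) ^ N * f - algebraMap R S r ∈ degreeIdeal e t := by
  induction t with
  | zero => exact ⟨0, fun f => ⟨0, by rw [degreeIdeal_zero]; trivial⟩⟩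
  | succ t ih =>
    obtain ⟨N, hN⟩ := ih
    refine ⟨t + N, fun f => ?_⟩
    obtain ⟨r, hr⟩ := hN f
    obtain ⟨s, hs⟩ := H.exists_sub_mem i hr
    refine ⟨x i ^ t * r + s, ?_⟩
    convert hs using 1
    simp only [map_add, map_mul, map_pow]
    ring

lemma exists_pow_mul_mem_pow (H : IsSegreLike x y e) (i : σ) (t : ℕ) :
    ∃ N, ∀ r : R, algebraMap R S r ∈ degreeIdeal e t →
      x i ^ N * r ∈ Ideal.span (Set.range fun p : σ × τ => y p.1 p.2) ^ t := by
  classical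
  induction t with
  | zero => exact ⟨0, fun r _ => by simp⟩
  | succ t ih =>
    obtain ⟨N, hN⟩ := ih
    refine ⟨t + N, fun r hr => ?_⟩
    set I := Ideal.span (Set.range fun p : σ × τ => y p.1 p.2)
    have hle : Ideal.span {x i} * I ≤ Ideal.span (Set.range (y i)) := by
      rw [Ideal.span_mul_span', Ideal.span_le]
      rintro _ ⟨_, rfl, _, ⟨⟨k, j⟩, rfl⟩, rfl⟩
      change x i * y k j ∈ _
      rw [H.minor]
      exact Ideal.mul_mem_left _ _ (Ideal.subset_span ⟨j, rfl⟩)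
    have hle' : Ideal.span (Set.range (y i)) ≤ I := by
      rw [Ideal.span_le]
      rintro _ ⟨j, rfl⟩
      exact Ideal.subset_span ⟨(i, j), rfl⟩
    have hs : x i ^ (t + N) * r ∈ Ideal.span (Set.range (y i)) ^ t := by
      refine Ideal.pow_right_mono hle t ?_
      rw [mul_pow, pow_add, mul_assoc]
      exact Ideal.mul_mem_mul (Ideal.pow_mem_pow (Ideal.mem_span_singleton_self _) t)
        (hN r (degreeIdeal_succ_le e t hr))
    obtain ⟨p, hp, hpe⟩ := (Ideal.mem_span_pow_iff_exists_isHomogeneous _ _).mp hs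
    rw [MvPolynomial.eval_eq] at hpe
    have hdeg {β : τ →₀ ℕ} (hβ : β ∈ p.support) : β.degree = t := by
      rw [Finsupp.degree_eq_weight_one]
      exact hp (MvPolynomial.mem_support_iff.mp hβ)
    have hmem {β : τ →₀ ℕ} (hβ : β ∈ p.support) :
        algebraMap R S (β.prod fun j k => y i j ^ k) ∈ degreeIdeal e t := by
      intro γ hγ
      rw [H.map_monomial, coeff_monomial_ne]
      rintro rfl
      exact hγ.ne (hdeg hβ)
    have hcoeff {β : τ →₀ ℕ} (hβ : β ∈ p.support) : MvPolynomial.coeff β p ∈ I := by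
      rw [← H.ker]
      have h0 : coeff β (e (algebraMap R S (x i ^ (t + N) * r))) = 0 := by
        rw [map_mul]
        exact Ideal.mul_mem_left _ _ hr β (by rw [hdeg hβ]; omega)
      rw [← hpe, map_sum, map_sum, map_sum, Finset.sum_eq_single β] at h0
      · change coeff β (e (algebraMap R S (_ * β.prod fun j k => y i j ^ k))) = 0 at h0
        rw [map_mul, coeff_mul_of_mem_degreeIdeal (hmem hβ) _ (hdeg hβ).le, H.constantCoeff,
          H.map_monomial, coeff_monomial_same, mul_comm] at h0
        generalize β.degree = d at h0
        induction d with
        | zero => simpa using h0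
        | succ d ih =>
          rw [pow_succ', mul_assoc] at h0
          exact ih (H.nonZeroDivisor i _ h0)
      · intro γ hγ hne
        change coeff β (e (algebraMap R S (_ * γ.prod fun j k => y i j ^ k))) = 0
        rw [map_mul, coeff_mul_of_mem_degreeIdeal (hmem hγ) _ (hdeg hβ).le, H.map_monomial,
          coeff_monomial_ne hne.symm, mul_zero]
      · exact fun h => absurd hβ h
    rw [← hpe, pow_succ']
    refine sum_mem fun β hβ => Ideal.mul_mem_mul (hcoeff hβ) (Ideal.pow_right_mono hle' t ?_)
    refine (Ideal.mem_span_pow_iff_exists_isHomogeneous _ _).mpr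
      ⟨MvPolynomial.monomial β 1, MvPolynomial.isHomogeneous_monomial _ (hdeg hβ), ?_⟩
    rw [MvPolynomial.eval_monomial, one_mul]
    rfl

/-- An ideal containing powers of all the `x i` and `y i j` contains a power of the ideal they
generate. -/
lemma exists_pow_span_le [Finite σ] [Finite τ] {K : Ideal R} (hx : ∀ i, ∃ N : ℕ, x i ^ N ∈ K)
    (hy : ∀ i j, ∃ N : ℕ, y i j ^ N ∈ K) :
    ∃ N, Ideal.span (Set.range x ∪ Set.range fun p : σ × τ => y p.1 p.2) ^ N ≤ K := by
  refine Ideal.exists_pow_le_of_le_radical_of_fg ?_ ?_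
  · rw [Ideal.span_le]
    rintro _ (⟨i, rfl⟩ | ⟨p, rfl⟩)
    · exact hx i
    · exact hy p.1 p.2
  · exact Submodule.fg_span ((Set.finite_range _).union (Set.finite_range _))

lemma algebraMap_eq_zero (H : IsSegreLike x y e) :
    ∀ r ∈ Ideal.span (Set.range fun p : σ × τ => y p.1 p.2), algebraMap R T r = 0 :=
  fun r hr => (H.ker r).mpr hr

lemma exists_forall_smul_eq_zero (H : IsSegreLike x y e) [Finite σ] [Finite τ] (t : ℕ) :
    ∃ N, ∀ r ∈ Ideal.span (Set.range x ∪ Set.range fun p : σ × τ => y p.1 p.2) ^ N, ∀ z,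
      powQuotToDegreeQuot e H.constantCoeff H.algebraMap_eq_zero t z = 0 → r • z = 0 := by
  set h := powQuotToDegreeQuot e H.constantCoeff H.algebraMap_eq_zero t
  obtain ⟨N, hN⟩ := exists_pow_span_le (x := x) (y := y)
    (K := Module.annihilator R (LinearMap.ker h))
    (fun i => by
      obtain ⟨N, hN⟩ := H.exists_pow_mul_mem_pow i t
      refine ⟨N, Module.mem_annihilator.mpr ?_⟩
      rintro ⟨z, hz⟩
      obtain ⟨r, rfl⟩ := Ideal.Quotient.mk_surjective z
      refine Subtype.ext (Ideal.Quotient.eq_zero_iff_mem.mpr (hN r ?_))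
      exact Ideal.Quotient.eq_zero_iff_mem.mp hz)
    (fun i j => by
      refine ⟨t, Module.mem_annihilator.mpr ?_⟩
      rintro ⟨z, hz⟩
      obtain ⟨r, rfl⟩ := Ideal.Quotient.mk_surjective z
      have hmem : y i j ∈ Ideal.span (Set.range fun p : σ × τ => y p.1 p.2) :=
        Ideal.subset_span ⟨(i, j), rfl⟩
      exact Subtype.ext (Ideal.Quotient.eq_zero_iff_mem.mpr
        (Ideal.mul_mem_right _ _ (Ideal.pow_mem_pow hmem t))))
  refine ⟨N, fun r hr z hz => ?_⟩
  have hz : z ∈ LinearMap.ker h := hz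
  have hr := Module.mem_annihilator.mp (hN hr)
  exact congrArg Subtype.val (hr ⟨z, hz⟩)

lemma exists_forall_smul_mem_range (H : IsSegreLike x y e) [Finite σ] [Finite τ] (t : ℕ) :
    ∃ N, ∀ r ∈ Ideal.span (Set.range x ∪ Set.range fun p : σ × τ => y p.1 p.2) ^ N, ∀ z,
      ∃ w, powQuotToDegreeQuot e H.constantCoeff H.algebraMap_eq_zero t w = r • z := by
  set h := powQuotToDegreeQuot e H.constantCoeff H.algebraMap_eq_zero t with hh
  obtain ⟨N, hN⟩ := exists_pow_span_le (x := x) (y := y)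
    (K := Module.annihilator R ((S ⧸ degreeIdeal e t) ⧸ LinearMap.range h))
    (fun i => by
      obtain ⟨N, hN⟩ := H.exists_pow_mul_sub_mem i t
      refine ⟨N, Module.mem_annihilator.mpr fun z => ?_⟩
      obtain ⟨z, rfl⟩ := Submodule.Quotient.mk_surjective _ z
      obtain ⟨f, rfl⟩ := Ideal.Quotient.mk_surjective z
      obtain ⟨r, hr⟩ := hN f
      rw [← Submodule.Quotient.mk_smul, Submodule.Quotient.mk_eq_zero]
      refine ⟨Ideal.Quotient.mk _ r, ?_⟩
      rw [hh, powQuotToDegreeQuot_mk, ← Ideal.Quotient.mkₐ_eq_mk R (degreeIdeal e t), ← map_smul,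
        Ideal.Quotient.mkₐ_eq_mk, eq_comm, Ideal.Quotient.mk_eq_mk_iff_sub_mem, Algebra.smul_def,
        map_pow]
      exact hr)
    (fun i j => by
      refine ⟨t, Module.mem_annihilator.mpr fun z => ?_⟩
      obtain ⟨z, rfl⟩ := Submodule.Quotient.mk_surjective _ z
      obtain ⟨f, rfl⟩ := Ideal.Quotient.mk_surjective z
      rw [← Submodule.Quotient.mk_smul, Submodule.Quotient.mk_eq_zero]
      convert Submodule.zero_mem _
      rw [← Ideal.Quotient.mkₐ_eq_mk R (degreeIdeal e t), ← map_smul,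
        Ideal.Quotient.mkₐ_eq_mk, Ideal.Quotient.eq_zero_iff_mem, Algebra.smul_def, map_pow]
      refine Ideal.mul_mem_right _ _ (pow_mem_degreeIdeal ?_ t)
      simp [H.map_y])
  refine ⟨N, fun r hr z => ?_⟩
  have := Module.mem_annihilator.mp (hN hr) (Submodule.Quotient.mk z)
  rwa [← Submodule.Quotient.mk_smul, Submodule.Quotient.mk_eq_zero] at this

lemma smul_eq_smul_smul (H : IsSegreLike x y e) (i : σ) (j : τ) (t : ℕ) (z : S ⧸ degreeIdeal e t) :
    y i j • z = x i • (Ideal.Quotient.mk (degreeIdeal e t) (e.symm (X j)) * z) := by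
  rw [Algebra.smul_def, Algebra.smul_def, ← mul_assoc]
  congr 1
  change Ideal.Quotient.mk _ (algebraMap R S (y i j)) =
    Ideal.Quotient.mk _ (algebraMap R S (x i)) * _
  rw [← map_mul]
  congr 1
  apply e.injective
  rw [H.map_y, map_mul, H.map_x, e.apply_symm_apply, mul_comm]

theorem isApproximatingTower {m : ℕ} {x : Fin m → R} {y : Fin m → τ → R} [Finite τ] [Nonempty τ]
    [Nontrivial T] (H : IsSegreLike x y e)
    (hreg : RingTheory.Sequence.IsWeaklyRegular T (List.ofFn x)) :
    IsApproximatingTower (Ideal.span (Set.range x ∪ Set.range fun p : Fin m × τ => y p.1 p.2))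
      (Ideal.span (Set.range fun p : Fin m × τ => y p.1 p.2)) (List.ofFn x)
      (homogeneousIncl e H.constantCoeff) (degreeTransition R e)
      (powQuotToDegreeQuot e H.constantCoeff H.algebraMap_eq_zero) where
  injective_i := homogeneousIncl_injective e H.constantCoeff
  exact := exact_homogeneousIncl_degreeTransition e H.constantCoeff
  surjective_c := degreeTransition_surjective e
  subsingleton_zero := by
    rw [degreeIdeal_zero]
    infer_instance
  finite_B t := by
    have : Module.Finite R T := Module.Finite.of_surjective (Algebra.linearMap R T) H.surjective
    infer_instance
  nontrivial_B t := inferInstance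
  regular_B t := isWeaklyRegular_pi _ _ _ hreg
  smul_mem_B t r hr v := by
    refine smul_pi_mem_smul_top _ _ (fun b => ?_) v
    induction hr using Submodule.span_induction with
    | zero => simp
    | add r s _ _ hr hs => rw [add_smul]; exact add_mem hr hs
    | smul a r _ hr => rw [smul_assoc]; exact Submodule.smul_mem _ _ hr
    | mem r hr =>
      obtain ⟨i, rfl⟩ | ⟨p, rfl⟩ := hr
      · exact Submodule.smul_mem_smul (Ideal.subset_span (by simp)) trivial
      · convert Submodule.zero_mem _
        rw [Algebra.smul_def, H.algebraMap_eq_zero _ (Ideal.subset_span ⟨p, rfl⟩), zero_mul]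
  c_h t := by
    ext
    rfl
  ker_h := H.exists_forall_smul_eq_zero
  coker_h := H.exists_forall_smul_mem_range
  smul_C := by
    refine ⟨_, rfl, ?_⟩
    rintro _ (⟨i, rfl⟩ | ⟨p, rfl⟩)
    · exact ⟨x i, by simp, fun t => ⟨LinearMap.id, fun z => rfl⟩⟩
    · exact ⟨x p.1, by simp, fun t => ⟨LinearMap.mulLeft R _, H.smul_eq_smul_smul p.1 p.2 t⟩⟩

end IsSegreLike
end Determinantal

section PowerSeries
variable {σ τ k : Type} [CommRing k]

/-- The iterated power series associated to a power series in two sets of variables. -/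
def sumPowerSeriesFun (f : MvPowerSeries (σ ⊕ τ) k) : MvPowerSeries τ (MvPowerSeries σ k) :=
  fun β α => coeff (Finsupp.sumFinsuppAddEquivProdFinsupp.symm (α, β)) f

/-- Power series in two sets of variables as power series in the second set of variables whose
coefficients are power series in the first. -/
def sumPowerSeriesEquiv (σ τ k : Type) [CommRing k] :
    MvPowerSeries (σ ⊕ τ) k ≃+* MvPowerSeries τ (MvPowerSeries σ k) where
  toFun := sumPowerSeriesFun
  invFun g := fun γ => coeff (Finsupp.sumFinsuppAddEquivProdFinsupp γ).1
    (coeff (Finsupp.sumFinsuppAddEquivProdFinsupp γ).2 g)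
  left_inv f := by
    ext γ
    exact congrArg (fun δ => coeff δ f) (Finsupp.sumFinsuppAddEquivProdFinsupp.symm_apply_apply γ)
  right_inv g := by
    ext β α
    have := Finsupp.sumFinsuppAddEquivProdFinsupp.apply_symm_apply (α, β)
    exact congrArg (fun p : (σ →₀ ℕ) × (τ →₀ ℕ) => coeff p.1 (coeff p.2 g)) this
  map_add' f g := rfl
  map_mul' f g := by
    classical
    ext β α
    refine (coeff_mul (Finsupp.sumFinsuppAddEquivProdFinsupp.symm (α, β)) f g).trans ?_
    refine Eq.trans ?_ (congrArg (coeff α)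
      (coeff_mul β (sumPowerSeriesFun f) (sumPowerSeriesFun g))).symm
    rw [map_sum]
    simp_rw [coeff_mul]
    rw [← Finset.sum_product']
    refine Finset.sum_equiv ((Equiv.prodCongr Finsupp.sumFinsuppAddEquivProdFinsupp.toEquiv
      Finsupp.sumFinsuppAddEquivProdFinsupp.toEquiv).trans
        ((Equiv.prodProdProdComm _ _ _ _).trans (Equiv.prodComm _ _))) ?_ ?_
    · rintro ⟨γ, δ⟩
      rw [Finset.HasAntidiagonal.mem_antidiagonal, AddEquiv.eq_symm_apply, map_add]
      simp [Prod.ext_iff, and_comm]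
    · rintro ⟨γ, δ⟩ _
      exact congrArg₂ (fun a b => coeff a f * coeff b g)
        (Finsupp.sumFinsuppAddEquivProdFinsupp.symm_apply_apply γ).symm
        (Finsupp.sumFinsuppAddEquivProdFinsupp.symm_apply_apply δ).symm

lemma coeff_coeff_sumPowerSeriesEquiv (f : MvPowerSeries (σ ⊕ τ) k) (α : σ →₀ ℕ) (β : τ →₀ ℕ) :
    coeff α (coeff β (sumPowerSeriesEquiv σ τ k f)) =
      coeff (Finsupp.sumFinsuppAddEquivProdFinsupp.symm (α, β)) f := rfl

lemma sumPowerSeriesEquiv_monomial (α : σ →₀ ℕ) (β : τ →₀ ℕ) (a : k) :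
    sumPowerSeriesEquiv σ τ k (monomial (Finsupp.sumFinsuppAddEquivProdFinsupp.symm (α, β)) a) =
      monomial β (monomial α a) := by
  classical
  ext β' α'
  rw [coeff_coeff_sumPowerSeriesEquiv, coeff_monomial, coeff_monomial]
  simp only [EmbeddingLike.apply_eq_iff_eq, Prod.mk.injEq]
  split_ifs with h1 h2 h2
  · rw [coeff_monomial, if_pos h1.1]
  · exact absurd h1.2 h2
  · rw [coeff_monomial, if_neg (fun h => h1 ⟨h, h2⟩)]
  · rw [map_zero]

lemma sumPowerSeriesEquiv_X_inr (j : τ) :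
    sumPowerSeriesEquiv σ τ k (X (Sum.inr j)) = X j := by
  have := sumPowerSeriesEquiv_monomial (σ := σ) (k := k) 0 (Finsupp.single j 1) 1
  refine Eq.trans (congrArg _ ?_) this
  rw [X]
  congr 2
  ext (i | i)
  · simp
  · simp

lemma sumPowerSeriesEquiv_rename_inl [Finite σ] (g : MvPowerSeries σ k) :
    sumPowerSeriesEquiv σ τ k (rename (Function.Embedding.inl : σ ↪ σ ⊕ τ) g) = C g := by
  classical
  ext β α
  rw [coeff_coeff_sumPowerSeriesEquiv, coeff_C]
  split_ifs with h
  · subst h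
    rw [← coeff_embDomain_rename (Function.Embedding.inl : σ ↪ σ ⊕ τ)]
    congr 2
    ext (i | i)
    · exact (Finsupp.embDomain_apply_self (Function.Embedding.inl : σ ↪ σ ⊕ τ) α i).symm
    · simp
  · rw [coeff_rename_eq_zero, map_zero]
    rintro ⟨γ, hγ⟩
    refine h (Finsupp.ext fun j => ?_)
    have := DFunLike.congr_fun hγ (Sum.inr j)
    rw [Finsupp.mapDomain_of_notMem_range _ _ (by simp)] at this
    exact this.symm

lemma mem_span_X_image_iff [Finite σ] (s : Set σ) (f : MvPowerSeries σ k) :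
    f ∈ Ideal.span (X '' s) ↔ ∀ α : σ →₀ ℕ, (∀ i ∈ s, α i = 0) → coeff α f = 0 := by
  classical
  constructor
  · intro hf
    induction hf using Submodule.span_induction with
    | zero => intro α _; rfl
    | add f g _ _ hf hg => intro α hα; rw [map_add, hf α hα, hg α hα, add_zero]
    | smul a f _ hf =>
      intro α hα
      rw [smul_eq_mul, coeff_mul]
      refine Finset.sum_eq_zero fun p hp => ?_
      rw [Finset.HasAntidiagonal.mem_antidiagonal] at hp
      rw [hf p.2 fun i hi => ?_, mul_zero]
      have := hα i hi
      rw [← hp, Finsupp.add_apply] at this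
      omega
    | mem f hf =>
      obtain ⟨i, hi, rfl⟩ := hf
      intro α hα
      rw [coeff_X, if_neg]
      rintro rfl
      simpa using hα i hi
  · revert f
    induction s, s.toFinite using Set.Finite.induction_on with
    | empty =>
      intro f hf
      have : f = 0 := by ext α; exact hf α (by simp)
      simp [this]
    | @insert a s ha hs ih =>
      intro f hf
      let g : MvPowerSeries σ k := fun α => if α a = 0 then coeff α f else 0
      have hg (α : σ →₀ ℕ) : coeff α g = if α a = 0 then coeff α f else 0 := rfl
      rw [← sub_add_cancel f g]
      refine add_mem ?_ (Ideal.span_mono (Set.image_mono (Set.subset_insert a s)) (ih g ?_))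
      · obtain ⟨q, hq⟩ := X_dvd_iff.mpr (show ∀ α : σ →₀ ℕ, α a = 0 → coeff α (f - g) = 0 from
          fun α hα => by rw [map_sub, hg, if_pos hα, sub_self])
        rw [hq]
        exact Ideal.mul_mem_right _ _ (Ideal.subset_span ⟨a, Set.mem_insert _ _, rfl⟩)
      · intro α hα
        rw [hg]
        split_ifs with h
        · exact hf α (by simpa [h] using hα)
        · rfl

lemma isWeaklyRegular_ofFn_X (m : ℕ) :
    RingTheory.Sequence.IsWeaklyRegular (MvPowerSeries (Fin m) k)
      (List.ofFn (X : Fin m → MvPowerSeries (Fin m) k)) := by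
  classical
  refine ⟨fun i hi => ?_⟩
  have him : i < m := by simpa using hi
  have hspan : (Ideal.ofList ((List.ofFn (X : Fin m → MvPowerSeries (Fin m) k)).take i) •
      (⊤ : Submodule (MvPowerSeries (Fin m) k) (MvPowerSeries (Fin m) k))) =
      Ideal.span (X '' {j : Fin m | (j : ℕ) < i}) := by
    rw [smul_eq_mul, Ideal.mul_top]
    refine congrArg Ideal.span ?_
    ext f
    constructor
    · intro hf
      obtain ⟨j, hj, rfl⟩ := List.mem_take_iff_getElem.mp hf
      have hj : j < i ∧ j < m := by simpa using hj
      exact ⟨⟨j, hj.2⟩, hj.1, by simp⟩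
    · rintro ⟨j, hj, rfl⟩
      have hj : (j : ℕ) < i := hj
      exact List.mem_take_iff_getElem.mpr ⟨j, by simp [hj], by simp⟩
  rw [hspan, isSMulRegular_iff_right_eq_zero_of_smul]
  intro z hz
  obtain ⟨f, rfl⟩ := Submodule.Quotient.mk_surjective _ z
  rw [← Submodule.Quotient.mk_smul, Submodule.Quotient.mk_eq_zero, mem_span_X_image_iff] at hz
  rw [Submodule.Quotient.mk_eq_zero, mem_span_X_image_iff]
  intro α hα
  have := hz (Finsupp.single ⟨i, him⟩ 1 + α) fun j hj => ?_
  · simpa [X, coeff_add_monomial_mul] using this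
  · rw [Finsupp.add_apply, hα j hj, Finsupp.single_apply, if_neg]
    rintro rfl
    exact lt_irrefl i hj

end PowerSeries

section DetRing

lemma det_minor (i k : Fin m) (j l : Fin n) :
    detx 𝕜 m n i j * detx 𝕜 m n k l = detx 𝕜 m n i l * detx 𝕜 m n k j := by
  have aux (i k : Fin m) (j l : Fin n) (hik : i < k) (hjl : j < l) :
      detx 𝕜 m n i j * detx 𝕜 m n k l = detx 𝕜 m n i l * detx 𝕜 m n k j := by
    refine (Ideal.Quotient.mk_eq_mk_iff_sub_mem _ _).mpr (Ideal.subset_span ?_)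
    exact ⟨i, k, j, l, hik, hjl, rfl⟩
  rcases lt_trichotomy i k with hik | rfl | hik
  · rcases lt_trichotomy j l with hjl | rfl | hjl
    · exact aux i k j l hik hjl
    · rfl
    · exact (aux i k l j hik hjl).symm
  · exact mul_comm _ _
  · rcases lt_trichotomy j l with hjl | rfl | hjl
    · rw [mul_comm, mul_comm (detx 𝕜 m n i l)]
      exact (aux k i j l hik hjl).symm
    · rfl
    · rw [mul_comm, mul_comm (detx 𝕜 m n i l)]
      exact aux k i l j hik hjl

/-- The images of the variables in the power series ring `S`. -/
def detVar (p : Fin m × Fin n) : DetS 𝕜 m n :=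
  if h : (p.2 : ℕ) < n - 1 then X (Sum.inr (⟨p.2, h⟩ : Fin (n - 1))) * X (Sum.inl p.1)
  else X (Sum.inl p.1)

lemma hasSubst_detVar : HasSubst (detVar 𝕜 m n) := by
  refine hasSubst_of_constantCoeff_zero fun p => ?_
  rw [detVar]
  split_ifs <;> simp

/-- The homomorphism from `R` to the power series ring `S` sending `x_{ij}` to `a_j x_i` and
`x_{in}` to `x_i`. -/
def detHom : DetR 𝕜 m n →+* DetS 𝕜 m n :=
  Ideal.Quotient.lift (detI2 𝕜 m n)
    (substAlgHom (R := 𝕜) (hasSubst_detVar 𝕜 m n)).toRingHom fun f hf => by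
      induction hf using Submodule.span_induction with
      | zero => exact map_zero _
      | add f g _ _ hf hg => rw [map_add, hf, hg, add_zero]
      | smul a f _ hf => rw [smul_eq_mul, map_mul, hf, mul_zero]
      | mem f hf =>
        obtain ⟨i, k, j, l, -, -, rfl⟩ := hf
        change substAlgHom (R := 𝕜) (hasSubst_detVar 𝕜 m n) _ = 0
        simp only [map_sub, map_mul, substAlgHom_X, detVar]
        split_ifs <;> ring

lemma detHom_mk (f : DetP 𝕜 m n) :
    detHom 𝕜 m n (Ideal.Quotient.mk _ f) = subst (detVar 𝕜 m n) f := by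
  rw [← coe_substAlgHom (hasSubst_detVar 𝕜 m n)]
  rfl

lemma detHom_detx (i : Fin m) (j : Fin n) :
    detHom 𝕜 m n (detx 𝕜 m n i j) = detVar 𝕜 m n (i, j) := by
  rw [detx, detHom_mk, subst_X (hasSubst_detVar 𝕜 m n)]

/-- The ring `S` as iterated power series. -/
abbrev detEquiv : DetS 𝕜 m n ≃+* MvPowerSeries (Fin (n - 1)) (MvPowerSeries (Fin m) 𝕜) :=
  sumPowerSeriesEquiv (Fin m) (Fin (n - 1)) 𝕜

lemma detEquiv_X_inl (i : Fin m) : detEquiv 𝕜 m n (X (Sum.inl i)) = C (X i) := by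
  rw [← sumPowerSeriesEquiv_rename_inl, rename_X]
  rfl

/-- The homomorphism from `R` to the power series ring in the entries of the last column, killing
the other columns. -/
def detProj : DetR 𝕜 m n →+* MvPowerSeries (Fin m) 𝕜 :=
  constantCoeff.comp ((detEquiv 𝕜 m n).toRingHom.comp (detHom 𝕜 m n))

lemma detProj_apply (r : DetR 𝕜 m n) :
    detProj 𝕜 m n r = constantCoeff (detEquiv 𝕜 m n (detHom 𝕜 m n r)) := rfl

variable (hn : 2 ≤ n)

/-- The index of the last column. -/
def detLast : Fin n := ⟨n - 1, by omega⟩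

/-- The entries of the last column. -/
def detLastCol (i : Fin m) : DetR 𝕜 m n := detx 𝕜 m n i (detLast n hn)

/-- The entries of the columns other than the last. -/
def detFstCols (i : Fin m) (j : Fin (n - 1)) : DetR 𝕜 m n := detx 𝕜 m n i ⟨j, by omega⟩

lemma detHom_detLastCol (i : Fin m) :
    detHom 𝕜 m n (detLastCol 𝕜 m n hn i) = X (Sum.inl i) := by
  rw [detLastCol, detHom_detx, detVar, dif_neg (by simp [detLast])]

lemma detHom_detFstCols (i : Fin m) (j : Fin (n - 1)) :
    detHom 𝕜 m n (detFstCols 𝕜 m n hn i j) = X (Sum.inr j) * X (Sum.inl i) := by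
  rw [detFstCols, detHom_detx, detVar, dif_pos j.2]

lemma detProj_detLastCol (i : Fin m) : detProj 𝕜 m n (detLastCol 𝕜 m n hn i) = X i := by
  rw [detProj_apply, detHom_detLastCol, detEquiv_X_inl, constantCoeff_C]

lemma detProj_detFstCols (i : Fin m) (j : Fin (n - 1)) :
    detProj 𝕜 m n (detFstCols 𝕜 m n hn i j) = 0 := by
  rw [detProj_apply, detHom_detFstCols, map_mul, sumPowerSeriesEquiv_X_inr, map_mul,
    constantCoeff_X, zero_mul]

/-- The inclusion of the indices of the last column. -/
def detLastEmb : Fin m ↪ Fin m × Fin n :=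
  ⟨fun i => (i, detLast n hn), fun _ _ h => congrArg Prod.fst h⟩

lemma detProj_mk_rename (g : MvPowerSeries (Fin m) 𝕜) :
    detProj 𝕜 m n (Ideal.Quotient.mk _ (rename (detLastEmb m n hn) g)) = g := by
  rw [detProj_apply, detHom_mk, rename_eq_subst,
    subst_comp_subst_apply (HasSubst.X_comp (detLastEmb m n hn)) (hasSubst_detVar 𝕜 m n)]
  have : (fun i => subst (detVar 𝕜 m n) ((X ∘ detLastEmb m n hn : Fin m → DetP 𝕜 m n) i)) =
      (X ∘ (Function.Embedding.inl : Fin m ↪ Fin m ⊕ Fin (n - 1)) : Fin m → DetS 𝕜 m n) := by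
    ext1 i
    rw [Function.comp_apply, subst_X (hasSubst_detVar 𝕜 m n)]
    exact dif_neg (by simp [detLastEmb, detLast])
  rw [this, ← rename_eq_subst, sumPowerSeriesEquiv_rename_inl, constantCoeff_C]

lemma detJ_eq_span :
    detJ 𝕜 m n = Ideal.span (Set.range fun p : Fin m × Fin (n - 1) =>
      detFstCols 𝕜 m n hn p.1 p.2) := by
  refine congrArg Ideal.span ?_
  ext r
  constructor
  · rintro ⟨i, j, hj, rfl⟩
    exact ⟨(i, ⟨j, hj⟩), rfl⟩
  · rintro ⟨⟨i, j⟩, rfl⟩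
    exact ⟨i, _, j.2, rfl⟩

lemma mk_sub_rename_killCompl_mem (f : DetP 𝕜 m n) :
    Ideal.Quotient.mk _ (f - rename (detLastEmb m n hn) (killCompl (detLastEmb m n hn) f)) ∈
      detJ 𝕜 m n := by
  have hf : f - rename (detLastEmb m n hn) (killCompl (detLastEmb m n hn) f) ∈
      Ideal.span (X '' {p : Fin m × Fin n | (p.2 : ℕ) < n - 1}) := by
    rw [mem_span_X_image_iff]
    intro α hα
    obtain ⟨γ, rfl⟩ : α ∈ Set.range (Finsupp.embDomain (detLastEmb m n hn)) := by
      rw [Finsupp.mem_range_embDomain_iff]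
      intro p hp
      have hp2 : ¬ (p.2 : ℕ) < n - 1 := fun h => Finsupp.mem_support_iff.mp hp (hα p h)
      refine ⟨p.1, Prod.ext rfl (Fin.ext ?_)⟩
      change n - 1 = (p.2 : ℕ)
      have := p.2.isLt
      omega
    rw [map_sub, coeff_embDomain_rename, coeff_killCompl, sub_self]
  have := Ideal.mem_map_of_mem (Ideal.Quotient.mk (detI2 𝕜 m n)) hf
  rw [Ideal.map_span] at this
  refine Ideal.span_mono ?_ this
  rintro _ ⟨_, ⟨p, hp, rfl⟩, rfl⟩
  exact ⟨p.1, p.2, hp, rfl⟩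

lemma detProj_eq_zero_iff (hn : 2 ≤ n) (r : DetR 𝕜 m n) :
    detProj 𝕜 m n r = 0 ↔ r ∈ detJ 𝕜 m n := by
  have hJ (r : DetR 𝕜 m n) (hr : r ∈ detJ 𝕜 m n) : detProj 𝕜 m n r = 0 := by
    rw [detJ_eq_span 𝕜 m n hn] at hr
    induction hr using Submodule.span_induction with
    | zero => exact map_zero _
    | add f g _ _ hf hg => rw [map_add, hf, hg, add_zero]
    | smul a f _ hf => rw [smul_eq_mul, map_mul, hf, mul_zero]
    | mem f hf =>
      obtain ⟨p, rfl⟩ := hf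
      exact detProj_detFstCols 𝕜 m n hn p.1 p.2
  refine ⟨fun h => ?_, hJ r⟩
  obtain ⟨f, rfl⟩ := Ideal.Quotient.mk_surjective r
  have hf := mk_sub_rename_killCompl_mem 𝕜 m n hn f
  have h0 := hJ _ hf
  rw [map_sub, map_sub, h, detProj_mk_rename, zero_sub, neg_eq_zero] at h0
  rwa [h0, map_zero, sub_zero] at hf

lemma maximalIdeal_detR [IsLocalRing (DetR 𝕜 m n)] :
    IsLocalRing.maximalIdeal (DetR 𝕜 m n) = Ideal.span (Set.range (detLastCol 𝕜 m n hn) ∪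
      Set.range fun p : Fin m × Fin (n - 1) => detFstCols 𝕜 m n hn p.1 p.2) := by
  have hle : Ideal.span (Set.range (detLastCol 𝕜 m n hn) ∪
      Set.range fun p : Fin m × Fin (n - 1) => detFstCols 𝕜 m n hn p.1 p.2) ≤
      IsLocalRing.maximalIdeal (DetR 𝕜 m n) := by
    have aux (r : DetR 𝕜 m n) (hr : constantCoeff (detHom 𝕜 m n r) = 0) :
        r ∈ IsLocalRing.maximalIdeal (DetR 𝕜 m n) := by
      rw [IsLocalRing.mem_maximalIdeal]
      intro hu
      have := (hu.map (detHom 𝕜 m n)).map constantCoeff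
      rw [hr] at this
      exact not_isUnit_zero this
    rw [Ideal.span_le]
    rintro _ (⟨i, rfl⟩ | ⟨p, rfl⟩)
    · exact aux _ (by rw [detHom_detLastCol, constantCoeff_X])
    · exact aux _ (by rw [detHom_detFstCols, map_mul, constantCoeff_X, zero_mul])
  refine le_antisymm (fun r hr => ?_) hle
  obtain ⟨f, rfl⟩ := Ideal.Quotient.mk_surjective r
  have hf : f - C (constantCoeff f) ∈ Ideal.span (X '' (Set.univ : Set (Fin m × Fin n))) := by
    rw [mem_span_X_image_iff]
    intro α hα
    have : α = 0 := Finsupp.ext fun i => hα i trivial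
    subst this
    simp
  have := Ideal.mem_map_of_mem (Ideal.Quotient.mk (detI2 𝕜 m n)) hf
  rw [Ideal.map_span] at this
  have hmem : Ideal.Quotient.mk (detI2 𝕜 m n) (f - C (constantCoeff f)) ∈
      Ideal.span (Set.range (detLastCol 𝕜 m n hn) ∪
        Set.range fun p : Fin m × Fin (n - 1) => detFstCols 𝕜 m n hn p.1 p.2) := by
    refine Ideal.span_mono ?_ this
    rintro _ ⟨_, ⟨p, -, rfl⟩, rfl⟩
    by_cases hp : (p.2 : ℕ) < n - 1
    · exact Or.inr ⟨(p.1, ⟨p.2, hp⟩), rfl⟩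
    · refine Or.inl ⟨p.1, congrArg (detx 𝕜 m n p.1) (Fin.ext ?_)⟩
      simp only [detLast]
      omega
  by_cases hc : constantCoeff f = 0
  · rwa [hc, map_zero, sub_zero] at hmem
  · have h1 := sub_mem hr (hle hmem)
    rw [← map_sub, sub_sub_cancel] at h1
    refine absurd ?_ ((IsLocalRing.mem_maximalIdeal _).mp h1)
    exact ((isUnit_iff_ne_zero.mpr hc).map C).map (Ideal.Quotient.mk (detI2 𝕜 m n))

/-- The power series ring `S` as an algebra over `R`. -/
abbrev detAlgebraS : Algebra (DetR 𝕜 m n) (DetS 𝕜 m n) := (detHom 𝕜 m n).toAlgebra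

/-- The power series ring in the last column as an algebra over `R`. -/
abbrev detAlgebraT : Algebra (DetR 𝕜 m n) (MvPowerSeries (Fin m) 𝕜) := (detProj 𝕜 m n).toAlgebra

lemma isSegreLike_det :
    letI := detAlgebraS 𝕜 m n
    letI := detAlgebraT 𝕜 m n
    IsSegreLike (detLastCol 𝕜 m n hn) (detFstCols 𝕜 m n hn) (detEquiv 𝕜 m n) := by
  let := detAlgebraS 𝕜 m n
  let := detAlgebraT 𝕜 m n
  have hS (r : DetR 𝕜 m n) : algebraMap (DetR 𝕜 m n) (DetS 𝕜 m n) r = detHom 𝕜 m n r := rfl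
  have hT (r : DetR 𝕜 m n) :
      algebraMap (DetR 𝕜 m n) (MvPowerSeries (Fin m) 𝕜) r = detProj 𝕜 m n r := rfl
  constructor
  · exact fun r => rfl
  · intro i
    rw [hS, hT, detHom_detLastCol, detProj_detLastCol, detEquiv_X_inl]
  · intro i j
    rw [hS, hT, detHom_detFstCols, detProj_detLastCol, map_mul, detEquiv_X_inl,
      sumPowerSeriesEquiv_X_inr]
  · intro i k j
    rw [mul_comm (detLastCol 𝕜 m n hn k)]
    exact det_minor 𝕜 m n i k _ _
  · exact fun g => ⟨_, detProj_mk_rename 𝕜 m n hn g⟩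
  · intro r
    rw [hT, detProj_eq_zero_iff 𝕜 m n hn, detJ_eq_span 𝕜 m n hn]
  · intro i a h
    rw [hT, detProj_detLastCol] at h
    exact (mul_eq_zero.mp h).resolve_left (nonZeroDivisors.ne_zero X_mem_nonzeroDivisors)

lemma isWeaklyRegular_det :
    letI := detAlgebraT 𝕜 m n
    RingTheory.Sequence.IsWeaklyRegular (R := DetR 𝕜 m n) (MvPowerSeries (Fin m) 𝕜)
      (List.ofFn (detLastCol 𝕜 m n hn)) := by
  let := detAlgebraT 𝕜 m n
  rw [← RingTheory.Sequence.isWeaklyRegular_map_algebraMap_iff (MvPowerSeries (Fin m) 𝕜),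
    List.map_ofFn]
  convert isWeaklyRegular_ofFn_X (k := 𝕜) m using 2
  exact funext fun i => detProj_detLastCol 𝕜 m n hn i

end DetRing

/-- for any canonical module `ω_R` of `R`, the socle
`Hom_R(𝕜, H^m_𝔪(H^{n-1}_I(ω_R)))` is an infinite-dimensional `𝕜`-vector space.  Since
this module is annihilated by `𝔪`, being infinite dimensional over `𝕜 = R/𝔪` is
equivalent to not being a finitely generated `R`-module. -/
theorem statement13 [IsLocalRing (DetR 𝕜 m n)] (hm : 2 ≤ m) (hn : 2 ≤ n)
    (ω : ModuleCat (DetR 𝕜 m n)) (hω : IsCanonicalModule (DetR 𝕜 m n) (m + n - 1) ω) :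
    ¬ Module.Finite (DetR 𝕜 m n)
      (IsLocalRing.ResidueField (DetR 𝕜 m n) →ₗ[DetR 𝕜 m n]
        ((localCohomology (IsLocalRing.maximalIdeal (DetR 𝕜 m n)) m).obj
          ((localCohomology (detJ 𝕜 m n) (n - 1)).obj ω))) := by
  let := detAlgebraS 𝕜 m n
  let := detAlgebraT 𝕜 m n
  obtain ⟨hfin, h0, ⟨h1⟩⟩ := hω
  have : Nonempty (Fin (n - 1)) := ⟨⟨0, by omega⟩⟩
  have hmn : n - 1 + (List.ofFn (detLastCol 𝕜 m n hn)).length = m + n - 1 := by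
    rw [List.length_ofFn]
    omega
  have htower := (isSegreLike_det 𝕜 m n hn).isApproximatingTower (isWeaklyRegular_det 𝕜 m n hn)
  rw [← maximalIdeal_detR 𝕜 m n hn] at htower
  have hlocal := maximalIdeal_detR 𝕜 m n hn
  have : Module.Finite (DetR 𝕜 m n) ω := hfin
  have hxs : ∀ r ∈ List.ofFn (detLastCol 𝕜 m n hn), r ∈ IsLocalRing.maximalIdeal (DetR 𝕜 m n) := by
    intro r hr
    rw [hlocal]
    exact Ideal.subset_span (Or.inl (List.mem_ofFn.mp hr))
  have key := htower.not_finite_socle (Y := ω) (q := n - 1) rfl hxs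
    (by rwa [List.length_ofFn])
    (fun j hj => by
      rw [hmn] at hj
      have := h0 j hj
      exact (derivedExtEquiv (ModuleCat.of (DetR 𝕜 m n)
        (IsLocalRing.ResidueField (DetR 𝕜 m n))) ω j).symm.toEquiv.subsingleton)
    (by
      rw [hmn]
      exact ((derivedExtEquiv (ModuleCat.of (DetR 𝕜 m n)
        (IsLocalRing.ResidueField (DetR 𝕜 m n))) ω _).symm.toEquiv.trans h1.toEquiv).nontrivial)
  rw [List.length_ofFn] at key
  rw [detJ_eq_span 𝕜 m n hn]
  exact key
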